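/- arXiv:2102.06363 — 6 statements merged into one kernel-verified Lean document; each statement's English description precedes it below -/
import Mathlib

section
/- The security measure Δ decomposes as Δ = I((C₁,C₂); (𝐗₁,𝐗₂)) + D(p_{C₁C₂} ‖ u), where I denotes mutual information, p_{C₁C₂} is the joint distribution of the ciphertext pair, and u is the uniform distribution on X₁^{m₁} × X₂^{m₂}. In particular Δ ≥ I((C₁,C₂); (𝐗₁,𝐗₂)), so Δ is at least as strict as the mutual-information security measure. -/
/-- Kullback–Leibler divergence (base 2) between two distributions on a finite type. -/
noncomputable def klDiv2 {α : Type*} [Fintype α] (p q : α → ℝ) : ℝ :=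
  ∑ a, p a * Real.logb 2 (p a / q a)

/-- The security measure `Δ` decomposes as
`Δ = I((C₁,C₂);(𝐗₁,𝐗₂)) + D(p_{C₁C₂} ‖ u)`; in particular `Δ ≥ I((C₁,C₂);(𝐗₁,𝐗₂))`. -/
theorem Delta_eq_mutualInfo_add_klDiv
    (X₁ X₂ : Type*) [Fintype X₁] [Fintype X₂] [DecidableEq X₁] [DecidableEq X₂]
    (n m₁ m₂ : ℕ) (hn : 0 < n) (hm₁ : 0 < m₁) (hm₂ : 0 < m₂)
    (Φ₁ : (Fin n → X₁) → (Fin n → X₁) → Fin m₁ → X₁)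
    (Φ₂ : (Fin n → X₂) → (Fin n → X₂) → Fin m₂ → X₂)
    -- `q` : joint key distribution, `p` : joint source distribution (independent of keys)
    (q : (Fin n → X₁) × (Fin n → X₂) → ℝ)
    (hq0 : ∀ k, 0 ≤ q k) (hq1 : ∑ k, q k = 1)
    (p : (Fin n → X₁) × (Fin n → X₂) → ℝ)
    (hp0 : ∀ x, 0 ≤ p x) (hp1 : ∑ x, p x = 1)
    -- conditional distribution of the ciphertext pair given the plaintext pair
    (cond : (Fin n → X₁) × (Fin n → X₂) → (Fin m₁ → X₁) × (Fin m₂ → X₂) → ℝ)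
    (hcond : ∀ x c, cond x c =
      ∑ k : (Fin n → X₁) × (Fin n → X₂),
        (if (Φ₁ k.1 x.1, Φ₂ k.2 x.2) = c then q k else 0))
    -- marginal distribution of the ciphertext pair
    (pC : (Fin m₁ → X₁) × (Fin m₂ → X₂) → ℝ)
    (hpC : ∀ c, pC c = ∑ x, p x * cond x c)
    -- uniform distribution on the ciphertext space
    (u : (Fin m₁ → X₁) × (Fin m₂ → X₂) → ℝ)
    (hu : ∀ c, u c = 1 / ((Fintype.card X₁ : ℝ) ^ m₁ * (Fintype.card X₂ : ℝ) ^ m₂))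
    -- the security measure Δ and the mutual information I((C₁,C₂);(𝐗₁,𝐗₂))
    (Δ MI : ℝ)
    (hΔ : Δ = ∑ x, p x * klDiv2 (cond x) u)
    (hMI : MI = ∑ x, ∑ c,
      p x * cond x c * Real.logb 2 (p x * cond x c / (p x * pC c))) :
    Δ = MI + klDiv2 pC u ∧ MI ≤ Δ := by
  have hc0 : ∀ x c, 0 ≤ cond x c := by
    intro x c
    rw [hcond]
    refine Finset.sum_nonneg fun k _ => ?_
    split_ifs
    · exact hq0 k
    · exact le_rfl
  have hc1 : ∀ x, ∑ c, cond x c = 1 := by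
    intro x
    simp_rw [hcond]
    rw [Finset.sum_comm, ← hq1]
    refine Finset.sum_congr rfl fun k _ => ?_
    rw [Finset.sum_ite_eq]
    simp
  have hpC0 : ∀ c, 0 ≤ pC c := by
    intro c
    rw [hpC]
    exact Finset.sum_nonneg fun x _ => mul_nonneg (hp0 x) (hc0 x c)
  have hpC1 : ∑ c, pC c = 1 := by
    simp_rw [hpC]
    rw [Finset.sum_comm]
    simp_rw [← Finset.mul_sum, hc1, mul_one]
    exact hp1
  have hne : Nonempty ((Fin n → X₁) × (Fin n → X₂)) := by
    by_contra h
    rw [not_nonempty_iff] at h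
    simp at hq1
  obtain ⟨k₁, k₂⟩ := hne
  haveI : Nonempty X₁ := ⟨k₁ ⟨0, hn⟩⟩
  haveI : Nonempty X₂ := ⟨k₂ ⟨0, hn⟩⟩
  have h1 : (0 : ℝ) < Fintype.card X₁ := by exact_mod_cast Fintype.card_pos
  have h2 : (0 : ℝ) < Fintype.card X₂ := by exact_mod_cast Fintype.card_pos
  have hu0 : ∀ c, 0 < u c := by
    intro c
    rw [hu]
    positivity
  have hu1 : ∑ c, u c = 1 := by
    simp_rw [hu]
    rw [Finset.sum_const, Finset.card_univ, Fintype.card_prod, Fintype.card_fun, Fintype.card_fun,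
      Fintype.card_fin, Fintype.card_fin, nsmul_eq_mul]
    push_cast
    field_simp
  have hlog2 : 0 < Real.log 2 := Real.log_pos (by norm_num)
  have hkl : 0 ≤ klDiv2 pC u := by
    have hterm : ∀ c, (pC c - u c) / Real.log 2 ≤ pC c * Real.logb 2 (pC c / u c) := by
      intro c
      rw [Real.logb, ← mul_div_assoc]
      refine div_le_div_of_nonneg_right ?_ hlog2.le
      rcases (hpC0 c).eq_or_lt with h | h
      · rw [← h]
        simp [(hu0 c).le]
      · have hpos : 0 < pC c / u c := div_pos h (hu0 c)
        have := Real.one_sub_inv_le_log_of_pos hpos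
        have h3 := mul_le_mul_of_nonneg_left this h.le
        refine le_trans (le_of_eq ?_) h3
        have := (hu0 c).ne'
        field_simp
    have hs := Finset.sum_le_sum fun c (_ : c ∈ Finset.univ) => hterm c
    rw [← Finset.sum_div, Finset.sum_sub_distrib, hpC1, hu1, sub_self, zero_div] at hs
    exact hs
  have hmain : Δ = MI + klDiv2 pC u := by
    have hk : klDiv2 pC u = ∑ x, ∑ c, p x * cond x c * Real.logb 2 (pC c / u c) := by
      rw [Finset.sum_comm]
      unfold klDiv2
      refine Finset.sum_congr rfl fun c _ => ?_
      rw [← Finset.sum_mul, ← hpC]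
    rw [hΔ, hMI, hk, ← Finset.sum_add_distrib]
    refine Finset.sum_congr rfl fun x _ => ?_
    rw [← Finset.sum_add_distrib, klDiv2, Finset.mul_sum]
    refine Finset.sum_congr rfl fun c _ => ?_
    rcases (hp0 x).eq_or_lt with h | h
    · simp [← h]
    rcases (hc0 x c).eq_or_lt with h' | h'
    · simp [← h']
    have hpos : 0 < pC c := by
      rw [hpC]
      exact lt_of_lt_of_le (mul_pos h h') (Finset.single_le_sum
        (f := fun x => p x * cond x c)
        (fun y _ => mul_nonneg (hp0 y) (hc0 y c)) (Finset.mem_univ x))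
    have hu' := hu0 c
    rw [mul_div_mul_left _ _ h.ne', ← mul_add, ← Real.logb_mul (by positivity) (by positivity),
      div_mul_div_cancel₀ hpos.ne', mul_assoc]
  exact ⟨hmain, by linarith⟩
end

section
/- Suppose the keys (𝐊₁,𝐊₂) = ((K_{1,1},…,K_{1,n}),(K_{2,1},…,K_{2,n})) form an i.i.d. sequence of pairs with per-letter distribution p_{K₁K₂} on X₁ × X₂, independent of the sources. Then the security measure satisfies Δ ≥ max{ m₁·log|X₁| − n·H(K₁), m₂·log|X₂| − n·H(K₂), m₁·log|X₁| + m₂·log|X₂| − n·H(K₁,K₂) }, where H(K₁), H(K₂), H(K₁,K₂) are the per-letter marginal and joint key entropies (base 2). -/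
/-- Shannon entropy (base 2) of a distribution on a finite type. -/
noncomputable def ent2 {α : Type*} [Fintype α] (p : α → ℝ) : ℝ :=
  - ∑ a, p a * Real.logb 2 (p a)

/-- Pushforward of a mass function. -/
noncomputable def pushM {α β : Type*} [Fintype α] [DecidableEq β] (f : α → β) (r : α → ℝ) : β → ℝ :=
  fun b => ∑ a, if f a = b then r a else 0

theorem pushM_sum {α β : Type*} [Fintype α] [Fintype β] [DecidableEq β] (f : α → β) (r : α → ℝ)
    (g : β → ℝ) : ∑ b, pushM f r b * g b = ∑ a, r a * g (f a) := by
  simp only [pushM, Finset.sum_mul]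
  rw [Finset.sum_comm]
  refine Finset.sum_congr rfl fun a _ => ?_
  simp [ite_mul]

theorem ent2_pushM_le {α β : Type*} [Fintype α] [Fintype β] [DecidableEq β] (f : α → β)
    (r : α → ℝ) (hr : ∀ a, 0 ≤ r a) : ent2 (pushM f r) ≤ ent2 r := by
  unfold ent2
  rw [pushM_sum f r (fun b => Real.logb 2 (pushM f r b))]
  apply neg_le_neg
  refine Finset.sum_le_sum fun a _ => ?_
  rcases (hr a).eq_or_lt with h | h
  · simp [← h]
  · refine mul_le_mul_of_nonneg_left ?_ (hr a)
    refine Real.logb_le_logb_of_le (by norm_num) h ?_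
    have := Finset.single_le_sum (f := fun a' => if f a' = f a then r a' else 0)
      (fun i _ => by split_ifs <;> simp [hr]) (Finset.mem_univ a)
    simpa [pushM] using this

theorem gibbs2 {α : Type*} [Fintype α] (p q : α → ℝ) (hp : ∀ a, 0 ≤ p a) (hq : ∀ a, 0 ≤ q a)
    (hac : ∀ a, q a = 0 → p a = 0) (hs : ∑ a, q a = ∑ a, p a) :
    ∑ a, p a * Real.logb 2 (q a) ≤ ∑ a, p a * Real.logb 2 (p a) := by
  have key : ∑ a, (p a * Real.log (q a) - p a * Real.log (p a)) ≤ ∑ a, (q a - p a) := by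
    refine Finset.sum_le_sum fun a _ => ?_
    rcases (hp a).eq_or_lt with h | h
    · simp [← h, hq a]
    · have hq' : 0 < q a := lt_of_le_of_ne (hq a) fun h' => h.ne' (hac a h'.symm)
      have := Real.log_le_sub_one_of_pos (div_pos hq' h)
      rw [Real.log_div hq'.ne' h.ne'] at this
      have h2 := mul_le_mul_of_nonneg_left this h.le
      have h3 : p a * (q a / p a - 1) = q a - p a := by field_simp
      linarith
  rw [Finset.sum_sub_distrib, Finset.sum_sub_distrib, hs, sub_self] at key
  have hl : 0 < Real.log 2 := Real.log_pos (by norm_num)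
  simp only [Real.logb, ← mul_div_assoc]
  rw [← Finset.sum_div, ← Finset.sum_div]
  exact div_le_div_of_nonneg_right (by linarith) hl.le

theorem ent2_le_marg {β γ : Type*} [Fintype β] [Fintype γ] [Nonempty γ] (P : β × γ → ℝ)
    (hP : ∀ a, 0 ≤ P a) (h1 : ∑ a, P a = 1) :
    ent2 P ≤ ent2 (fun b => ∑ c, P (b, c)) + Real.logb 2 (Fintype.card γ) := by
  have hc : (Fintype.card γ : ℝ) ≠ 0 := by simp
  have hz : ∀ a : β × γ, ∑ c, P (a.1, c) = 0 → P a = 0 := fun a h =>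
    (Finset.sum_eq_zero_iff_of_nonneg (fun c _ => hP (a.1, c))).1 h a.2 (Finset.mem_univ _)
  have := gibbs2 P (fun a => (∑ c, P (a.1, c)) / Fintype.card γ) hP
    (fun a => div_nonneg (Finset.sum_nonneg fun c _ => hP _) (by positivity))
    (fun a h => hz a (by simpa [hc] using h))
    (by
      rw [Fintype.sum_prod_type, Fintype.sum_prod_type]
      refine Finset.sum_congr rfl fun b _ => ?_
      simp; field_simp)
  have h2 : ∑ a, P a * Real.logb 2 ((∑ c, P (a.1, c)) / Fintype.card γ)
      = ∑ a, (P a * Real.logb 2 (∑ c, P (a.1, c)) - P a * Real.logb 2 (Fintype.card γ)) := by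
    refine Finset.sum_congr rfl fun a _ => ?_
    by_cases h : ∑ c, P (a.1, c) = 0
    · simp [hz a h]
    · rw [Real.logb_div h hc]; ring
  rw [h2, Finset.sum_sub_distrib, ← Finset.sum_mul, h1, Fintype.sum_prod_type] at this
  simp only [← Finset.sum_mul] at this
  unfold ent2
  linarith

theorem ent2_comp_equiv {α β : Type*} [Fintype α] [Fintype β] (e : α ≃ β) (P : β → ℝ) :
    ent2 (fun a => P (e a)) = ent2 P := by
  unfold ent2
  rw [← Equiv.sum_comp e (fun b => P b * Real.logb 2 (P b))]

theorem ent2_pi {α : Type*} [Fintype α] (n : ℕ) (p : α → ℝ) (h1 : ∑ a, p a = 1) :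
    ent2 (fun k : Fin n → α => ∏ t, p (k t)) = n * ent2 p := by
  classical
  unfold ent2
  have h : ∀ k : Fin n → α, (∏ t, p (k t)) * Real.logb 2 (∏ t, p (k t))
      = ∑ s, ∏ t, (if t = s then p (k t) * Real.logb 2 (p (k t)) else p (k t)) := by
    intro k
    have h' : ∀ s, ∏ t, (if t = s then p (k t) * Real.logb 2 (p (k t)) else p (k t))
        = (∏ t, p (k t)) * Real.logb 2 (p (k s)) := by
      intro s
      have : ∀ t, (if t = s then p (k t) * Real.logb 2 (p (k t)) else p (k t))
          = p (k t) * (if t = s then Real.logb 2 (p (k t)) else 1) := by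
        intro t; split_ifs <;> simp
      simp_rw [this]
      rw [Finset.prod_mul_distrib]
      simp
    simp_rw [h']
    rw [← Finset.mul_sum]
    by_cases hz : ∏ t, p (k t) = 0
    · simp [hz]
    · rw [Real.logb_prod]
      intro t ht h0
      exact hz (Finset.prod_eq_zero ht h0)
  simp_rw [h]
  rw [Finset.sum_comm]
  have h2 : ∀ s : Fin n, ∑ k : Fin n → α,
      ∏ t, (if t = s then p (k t) * Real.logb 2 (p (k t)) else p (k t))
      = ∑ a, p a * Real.logb 2 (p a) := by
    intro s
    have := (Finset.prod_univ_sum (fun _ : Fin n => (Finset.univ : Finset α))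
      (fun t a => if t = s then p a * Real.logb 2 (p a) else p a)).symm
    rw [Fintype.piFinset_univ] at this
    rw [this, Finset.prod_eq_single s]
    · simp
    · intro t _ ht; simp [ht, h1]
    · simp
  simp [h2]

theorem sum_pi_prod {α β : Type*} [Fintype β] (n : ℕ) (p : α × β → ℝ) (k : Fin n → α) :
    ∑ l : Fin n → β, ∏ t, p (k t, l t) = ∏ t, ∑ b, p (k t, b) := by
  classical
  have := (Finset.prod_univ_sum (fun _ : Fin n => (Finset.univ : Finset β))
      (fun t b => p (k t, b)))
  rw [Fintype.piFinset_univ] at this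
  exact this.symm

/-- Marginal bound. -/
theorem marg_bound {A B C E : Type*} [Fintype A] [Fintype B] [Fintype C] [Fintype E] [Nonempty E]
    [DecidableEq C] [DecidableEq E]
    (n : ℕ) (pK : A × B → ℝ) (h0 : ∀ a, 0 ≤ pK a) (h1 : ∑ a, pK a = 1)
    (f : (Fin n → A) → C) (g : (Fin n → B) → E) (P : C × E → ℝ) (hP0 : ∀ c, 0 ≤ P c)
    (hP1 : ∑ c, P c = 1)
    (hP : ∀ c, P c = ∑ k : (Fin n → A) × (Fin n → B),
      if (f k.1, g k.2) = c then ∏ t, pK (k.1 t, k.2 t) else 0) :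
    ent2 P ≤ n * ent2 (fun a => ∑ b, pK (a, b)) + Real.logb 2 (Fintype.card E) := by
  refine (ent2_le_marg P hP0 hP1).trans (add_le_add_left ?_ _)
  have hm : (fun c => ∑ e, P (c, e)) = pushM f (fun k => ∏ t, ∑ b, pK (k t, b)) := by
    funext c
    simp_rw [hP, pushM]
    rw [Finset.sum_comm, Fintype.sum_prod_type]
    refine Finset.sum_congr rfl fun k _ => ?_
    rw [← sum_pi_prod]
    by_cases h : f k = c
    · simp [h]
    · simp [h]
  rw [hm, ← ent2_pi n _ (by rw [← h1, Fintype.sum_prod_type])]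
  exact ent2_pushM_le _ _ fun k => Finset.prod_nonneg fun t _ => Finset.sum_nonneg fun b _ => h0 _

/-- With i.i.d. keys of per-letter distribution `pK`, independent of
the sources, the security measure satisfies
`Δ ≥ max{m₁·log|X₁| − n·H(K₁), m₂·log|X₂| − n·H(K₂), m₁·log|X₁| + m₂·log|X₂| − n·H(K₁K₂)}`. -/
theorem Delta_ge_max_key_entropy_bounds
    (X₁ X₂ : Type*) [Fintype X₁] [Fintype X₂] [DecidableEq X₁] [DecidableEq X₂]
    (n m₁ m₂ : ℕ) (hn : 0 < n) (hm₁ : 0 < m₁) (hm₂ : 0 < m₂)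
    (Φ₁ : (Fin n → X₁) → (Fin n → X₁) → Fin m₁ → X₁)
    (Φ₂ : (Fin n → X₂) → (Fin n → X₂) → Fin m₂ → X₂)
    -- per-letter key distribution
    (pK : X₁ × X₂ → ℝ) (hpK0 : ∀ a, 0 ≤ pK a) (hpK1 : ∑ a, pK a = 1)
    -- i.i.d. joint key distribution
    (q : (Fin n → X₁) × (Fin n → X₂) → ℝ)
    (hq : ∀ k, q k = ∏ t, pK (k.1 t, k.2 t))
    -- source distribution, independent of the keys
    (p : (Fin n → X₁) × (Fin n → X₂) → ℝ)
    (hp0 : ∀ x, 0 ≤ p x) (hp1 : ∑ x, p x = 1)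
    -- conditional distribution of the ciphertext pair given the plaintext pair
    (cond : (Fin n → X₁) × (Fin n → X₂) → (Fin m₁ → X₁) × (Fin m₂ → X₂) → ℝ)
    (hcond : ∀ x c, cond x c =
      ∑ k : (Fin n → X₁) × (Fin n → X₂),
        (if (Φ₁ k.1 x.1, Φ₂ k.2 x.2) = c then q k else 0))
    (u : (Fin m₁ → X₁) × (Fin m₂ → X₂) → ℝ)
    (hu : ∀ c, u c = 1 / ((Fintype.card X₁ : ℝ) ^ m₁ * (Fintype.card X₂ : ℝ) ^ m₂))
    (Δ : ℝ)
    (hΔ : Δ = ∑ x, p x * klDiv2 (cond x) u) :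
    max (max
        ((m₁ : ℝ) * Real.logb 2 (Fintype.card X₁) - n * ent2 (fun a => ∑ b, pK (a, b)))
        ((m₂ : ℝ) * Real.logb 2 (Fintype.card X₂) - n * ent2 (fun b => ∑ a, pK (a, b))))
      ((m₁ : ℝ) * Real.logb 2 (Fintype.card X₁) + (m₂ : ℝ) * Real.logb 2 (Fintype.card X₂)
        - n * ent2 pK) ≤ Δ := by
  have hne : Nonempty (X₁ × X₂) := by
    by_contra h
    rw [not_nonempty_iff] at h
    simp at hpK1
  obtain ⟨⟨a₀, b₀⟩⟩ := hne
  have : Nonempty X₁ := ⟨a₀⟩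
  have : Nonempty X₂ := ⟨b₀⟩
  have hq0 : ∀ k, 0 ≤ q k := fun k => by
    rw [hq]; exact Finset.prod_nonneg fun t _ => hpK0 _
  have hqe : (fun k : Fin n → X₁ × X₂ => q (Equiv.arrowProdEquivProdArrow (Fin n) (fun _ => X₁) (fun _ => X₂) k))
      = fun k => ∏ t, pK (k t) := by
    funext k; rw [hq]; rfl
  have hqent : ent2 q = n * ent2 pK := by
    rw [← ent2_comp_equiv (Equiv.arrowProdEquivProdArrow (Fin n) (fun _ => X₁) (fun _ => X₂)) q, hqe,
      ent2_pi n pK hpK1]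
  have hq1 : ∑ k, q k = 1 := by
    rw [Fintype.sum_prod_type]
    simp_rw [hq, sum_pi_prod]
    have := (Finset.prod_univ_sum (fun _ : Fin n => (Finset.univ : Finset X₁))
      (fun t a => ∑ b, pK (a, b)))
    rw [Fintype.piFinset_univ] at this
    rw [← this, ← Fintype.sum_prod_type, hpK1]
    simp
  have hpush : ∀ x, cond x = pushM (fun k => (Φ₁ k.1 x.1, Φ₂ k.2 x.2)) q := by
    intro x; funext c; rw [hcond]; rfl
  have hc0 : ∀ x c, 0 ≤ cond x c := fun x c => by
    rw [hcond]; exact Finset.sum_nonneg fun k _ => by split_ifs <;> simp [hq0]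
  have hc1 : ∀ x, ∑ c, cond x c = 1 := fun x => by
    have := pushM_sum (fun k : (Fin n → X₁) × (Fin n → X₂) => (Φ₁ k.1 x.1, Φ₂ k.2 x.2)) q (fun _ => 1)
    rw [hpush]
    simpa [hq1] using this
  have hN1 : (Fintype.card X₁ : ℝ) ≠ 0 := by simp
  have hN2 : (Fintype.card X₂ : ℝ) ≠ 0 := by simp
  have hkl : ∀ x, klDiv2 (cond x) u = (m₁ : ℝ) * Real.logb 2 (Fintype.card X₁)
      + (m₂ : ℝ) * Real.logb 2 (Fintype.card X₂) - ent2 (cond x) := by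
    intro x
    unfold klDiv2 ent2
    have : ∀ c, cond x c * Real.logb 2 (cond x c / u c) =
        cond x c * Real.logb 2 (cond x c) + cond x c * ((m₁ : ℝ) * Real.logb 2 (Fintype.card X₁)
      + (m₂ : ℝ) * Real.logb 2 (Fintype.card X₂)) := by
      intro c
      by_cases h : cond x c = 0
      · simp [h]
      · rw [hu, div_div_eq_mul_div, div_one, Real.logb_mul h (by positivity),
          Real.logb_mul (by positivity) (by positivity), Real.logb_pow, Real.logb_pow]
        ring
    simp_rw [this]
    rw [Finset.sum_add_distrib, ← Finset.sum_mul, hc1]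
    ring
  have hfin : ∀ L : ℝ, (∀ x, L ≤ klDiv2 (cond x) u) → L ≤ Δ := by
    intro L hL
    rw [hΔ]
    calc L = ∑ x, p x * L := by rw [← Finset.sum_mul, hp1, one_mul]
      _ ≤ _ := Finset.sum_le_sum fun x _ => mul_le_mul_of_nonneg_left (hL x) (hp0 x)
  refine max_le (max_le ?_ ?_) ?_ <;> refine hfin _ fun x => ?_ <;> rw [hkl]
  · have := marg_bound n pK hpK0 hpK1 (fun k => Φ₁ k x.1) (fun k => Φ₂ k x.2) (cond x) (hc0 x)
      (hc1 x) (fun c => by rw [hcond]; simp_rw [hq])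
    simp only [Fintype.card_pi, Finset.prod_const, Finset.card_univ, Fintype.card_fin,
      Nat.cast_pow, Real.logb_pow] at this
    linarith
  · have := marg_bound n (fun a => pK a.swap) (fun a => hpK0 _)
      (by rw [← hpK1]; exact Equiv.sum_comp (Equiv.prodComm X₂ X₁) pK)
      (fun k => Φ₂ k x.2) (fun k => Φ₁ k x.1) (fun c => cond x (Equiv.prodComm _ _ c))
      (fun c => hc0 x _)
      (by rw [← hc1 x]; exact Equiv.sum_comp (Equiv.prodComm _ _) (cond x))
      (fun c => by
        rw [hcond, ← Equiv.sum_comp (Equiv.prodComm _ _)]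
        refine Finset.sum_congr rfl fun k _ => ?_
        rw [hq]
        refine if_congr ?_ rfl rfl
        simp [Prod.ext_iff, and_comm])
    rw [ent2_comp_equiv] at this
    simp only [Fintype.card_pi, Finset.prod_const, Finset.card_univ, Fintype.card_fin,
      Nat.cast_pow, Real.logb_pow, Prod.swap_prod_mk] at this
    linarith
  · have := ent2_pushM_le (fun k : (Fin n → X₁) × (Fin n → X₂) => (Φ₁ k.1 x.1, Φ₂ k.2 x.2)) q hq0
    rw [← hpush, hqent] at this
    linarith
end

section
/- If a rate pair (R₁,R₂) is (ε,δ)-admissible, then for every γ > 0 there exists n₀ such that for all n ≥ n₀: R₁ ≤ H(K₁) + γ + ε/n, R₂ ≤ H(K₂) + γ + ε/n, and R₁ + R₂ ≤ H(K₁,K₂) + γ + ε/n, where H(K₁), H(K₂), H(K₁,K₂) are the per-letter key entropies (base 2). -/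
/-- Entropy (base 2) of the first marginal of a joint per-letter distribution. -/
noncomputable def entFst {X₁ X₂ : Type*} [Fintype X₁] [Fintype X₂]
    (p : X₁ × X₂ → ℝ) : ℝ :=
  ent2 (fun a => ∑ b, p (a, b))

/-- Entropy (base 2) of the second marginal of a joint per-letter distribution. -/
noncomputable def entSnd {X₁ X₂ : Type*} [Fintype X₁] [Fintype X₂]
    (p : X₁ × X₂ → ℝ) : ℝ :=
  ent2 (fun b => ∑ a, p (a, b))

/-- A distributed source encryption system at blocklength `n`:
surjective encoders `enc₁, enc₂`, injective joint decoder `dec`, encryption maps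
`Enc₁, Enc₂` (first argument the key, second the plaintext), decryption map `Dec`
satisfying the decodability Condition and injective in the ciphertexts for every
fixed key pair. -/
structure DES (X₁ X₂ : Type*) (n : ℕ) where
  m₁ : ℕ
  m₂ : ℕ
  enc₁ : (Fin n → X₁) → Fin m₁ → X₁
  enc₂ : (Fin n → X₂) → Fin m₂ → X₂
  dec : (Fin m₁ → X₁) × (Fin m₂ → X₂) → (Fin n → X₁) × (Fin n → X₂)
  Enc₁ : (Fin n → X₁) → (Fin n → X₁) → Fin m₁ → X₁
  Enc₂ : (Fin n → X₂) → (Fin n → X₂) → Fin m₂ → X₂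
  Dec : (Fin n → X₁) × (Fin n → X₂) → (Fin m₁ → X₁) × (Fin m₂ → X₂) →
    (Fin n → X₁) × (Fin n → X₂)
  henc₁ : Function.Surjective enc₁
  henc₂ : Function.Surjective enc₂
  hdec : Function.Injective dec
  hcond : ∀ k₁ k₂ x₁ x₂, Dec (k₁, k₂) (Enc₁ k₁ x₁, Enc₂ k₂ x₂) = dec (enc₁ x₁, enc₂ x₂)
  hDec : ∀ k, Function.Injective (Dec k)

variable {X₁ X₂ : Type*} [Fintype X₁] [Fintype X₂] [DecidableEq X₁] [DecidableEq X₂]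

/-- Error probability of the system with i.i.d. sources of per-letter
distribution `pX`. -/
noncomputable def pErr {n : ℕ} (S : DES X₁ X₂ n) (pX : X₁ × X₂ → ℝ) : ℝ :=
  ∑ x : (Fin n → X₁) × (Fin n → X₂),
    if S.dec (S.enc₁ x.1, S.enc₂ x.2) ≠ x then ∏ t, pX (x.1 t, x.2 t) else 0

/-- Conditional distribution of the ciphertext pair given the plaintext pair,
with i.i.d. keys of per-letter distribution `pK` independent of the sources. -/
noncomputable def condDist {n : ℕ} (S : DES X₁ X₂ n) (pK : X₁ × X₂ → ℝ)
    (x : (Fin n → X₁) × (Fin n → X₂))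
    (c : (Fin S.m₁ → X₁) × (Fin S.m₂ → X₂)) : ℝ :=
  ∑ k : (Fin n → X₁) × (Fin n → X₂),
    if (S.Enc₁ k.1 x.1, S.Enc₂ k.2 x.2) = c then ∏ t, pK (k.1 t, k.2 t) else 0

/-- The security measure `Δ⁽ⁿ⁾` of the system, with i.i.d. sources `pX` and
i.i.d. keys `pK` (keys independent of sources). -/
noncomputable def DeltaN {n : ℕ} (S : DES X₁ X₂ n) (pX pK : X₁ × X₂ → ℝ) : ℝ :=
  ∑ x : (Fin n → X₁) × (Fin n → X₂),
    (∏ t, pX (x.1 t, x.2 t)) *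
      klDiv2 (condDist S pK x)
        (fun _ => 1 / ((Fintype.card X₁ : ℝ) ^ S.m₁ * (Fintype.card X₂ : ℝ) ^ S.m₂))

/-- `(R₁, R₂)` is `(ε, δ)`-admissible. -/
def Admissible (pX pK : X₁ × X₂ → ℝ) (ε δ R₁ R₂ : ℝ) : Prop :=
  ∃ S : (n : ℕ) → DES X₁ X₂ n, ∀ γ : ℝ, 0 < γ → ∃ n₀ : ℕ, ∀ n : ℕ, n₀ ≤ n →
    (R₁ - γ ≤ ((S n).m₁ : ℝ) / (n : ℝ) * Real.logb 2 (Fintype.card X₁) ∧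
      ((S n).m₁ : ℝ) / (n : ℝ) * Real.logb 2 (Fintype.card X₁) ≤ R₁ + γ) ∧
    (R₂ - γ ≤ ((S n).m₂ : ℝ) / (n : ℝ) * Real.logb 2 (Fintype.card X₂) ∧
      ((S n).m₂ : ℝ) / (n : ℝ) * Real.logb 2 (Fintype.card X₂) ≤ R₂ + γ) ∧
    pErr (S n) pX ≤ δ ∧ DeltaN (S n) pX pK ≤ ε

section Helpers

theorem gibbs_aux {C : Type*} [Fintype C] (Q r : C → ℝ) (hQ : ∀ c, 0 ≤ Q c)
    (hQ1 : ∑ c, Q c = 1) (hr : ∀ c, 0 ≤ r c) (hr1 : ∑ c, r c ≤ 1)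
    (hpos : ∀ c, 0 < Q c → 0 < r c) :
    ∑ c, Q c * Real.logb 2 (r c) ≤ ∑ c, Q c * Real.logb 2 (Q c) := by
  have h2 : 0 < Real.log 2 := Real.log_pos (by norm_num)
  have key : ∀ c, Q c * Real.logb 2 (r c) - Q c * Real.logb 2 (Q c) ≤ (r c - Q c) / Real.log 2 := by
    intro c
    rcases (hQ c).eq_or_lt with h | h
    · rw [← h]; simp only [zero_mul, sub_zero]; exact div_nonneg (hr c) h2.le
    · have hrc := hpos c h
      have := Real.log_le_sub_one_of_pos (div_pos hrc h)
      rw [Real.log_div hrc.ne' h.ne'] at this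
      have h3 := mul_le_mul_of_nonneg_left this h.le
      have h4 : Q c * (r c / Q c - 1) = r c - Q c := by field_simp
      rw [h4] at h3
      rw [Real.logb, Real.logb, ← mul_div_assoc, ← mul_div_assoc, ← sub_div]
      apply div_le_div_of_nonneg_right _ h2.le
      linarith
  have := Finset.sum_le_sum (fun c (_ : c ∈ Finset.univ) => key c)
  rw [Finset.sum_sub_distrib, ← Finset.sum_div, Finset.sum_sub_distrib, hQ1] at this
  have h5 : (∑ c, r c - 1) / Real.log 2 ≤ 0 := div_nonpos_of_nonpos_of_nonneg (by linarith) h2.le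
  linarith

theorem push_sum {A C : Type*} [Fintype A] [Fintype C] [DecidableEq C] (P : A → ℝ) (f : A → C)
    (L : C → ℝ) :
    ∑ c, (∑ a, if f a = c then P a else 0) * L c = ∑ a, P a * L (f a) := by
  simp_rw [Finset.sum_mul]
  rw [Finset.sum_comm]
  refine Finset.sum_congr rfl fun a _ => ?_
  simp [ite_mul]

theorem push_ent {A C : Type*} [Fintype A] [Fintype C] [DecidableEq C] (P : A → ℝ) (f : A → C)
    (r : C → ℝ) (w : A → ℝ) (hP : ∀ a, 0 ≤ P a) (hP1 : ∑ a, P a = 1)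
    (hr : ∀ c, 0 ≤ r c) (hr1 : ∑ c, r c ≤ 1) (hw : ∀ a, 0 < P a → 0 < w a)
    (hwr : ∀ a, w a ≤ r (f a)) :
    ∑ a, P a * Real.logb 2 (w a) ≤
      ∑ c, (∑ a, if f a = c then P a else 0) *
        Real.logb 2 (∑ a, if f a = c then P a else 0) := by
  have h1 : ∑ a, P a * Real.logb 2 (w a) ≤ ∑ a, P a * Real.logb 2 (r (f a)) := by
    refine Finset.sum_le_sum fun a _ => ?_
    rcases (hP a).eq_or_lt with h | h
    · rw [← h]; simp
    · exact mul_le_mul_of_nonneg_left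
        (Real.logb_le_logb_of_le (by norm_num) (hw a h) (hwr a)) h.le
  rw [← push_sum P f (fun c => Real.logb 2 (r c))] at h1
  refine h1.trans (gibbs_aux _ r ?_ ?_ hr hr1 ?_)
  · intro c
    exact Finset.sum_nonneg fun a _ => by split_ifs; exacts [hP a, le_rfl]
  · have := push_sum P f (fun _ => 1)
    simpa [hP1] using this
  · intro c hc
    obtain ⟨a, -, ha⟩ := Finset.exists_lt_of_sum_lt (s := Finset.univ) (f := fun _ : A => (0:ℝ))
      (by simpa using hc)
    split_ifs at ha with h
    · rw [← h]; exact (hw a ha).trans_le (hwr a)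
    · exact absurd ha (lt_irrefl _)

theorem iid_sum {A : Type*} [Fintype A] (n : ℕ) (p : A → ℝ) :
    ∑ k : Fin n → A, ∏ t, p (k t) = (∑ a, p a) ^ n := by
  classical
  have := Finset.prod_univ_sum (fun _ : Fin n => (Finset.univ : Finset A)) (fun _ a => p a)
  simpa using this.symm

theorem iid_lin {A : Type*} [Fintype A] (n : ℕ) (p L : A → ℝ) (hp1 : ∑ a, p a = 1) :
    ∑ k : Fin n → A, (∏ t, p (k t)) * ∑ t, L (k t) = n * ∑ a, p a * L a := by
  classical
  simp_rw [Finset.mul_sum]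
  rw [Finset.sum_comm]
  have : ∀ t : Fin n, ∑ k : Fin n → A, (∏ s, p (k s)) * L (k t) = ∑ a, p a * L a := by
    intro t
    have := Finset.prod_univ_sum (fun _ : Fin n => (Finset.univ : Finset A))
      (fun s a => p a * if s = t then L a else 1)
    simp only [Fintype.piFinset_univ, Finset.prod_mul_distrib] at this
    simp only [Finset.prod_ite_eq', Finset.mem_univ, if_true] at this
    rw [← this, Finset.prod_eq_single t]
    · simp
    · intro b _ hb; simp [hb, hp1]
    · simp
  simp_rw [this]
  simp [Finset.mul_sum]

theorem iid_sum2 {X₁ X₂ : Type*} [Fintype X₁] [Fintype X₂] (n : ℕ) (p : X₁ × X₂ → ℝ)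
    (hp1 : ∑ a, p a = 1) :
    ∑ k : (Fin n → X₁) × (Fin n → X₂), ∏ t, p (k.1 t, k.2 t) = 1 := by
  have := iid_sum n p
  rw [hp1, one_pow] at this
  rw [← this]
  exact ((Equiv.arrowProdEquivProdArrow (Fin n) (fun _ => X₁) (fun _ => X₂)).sum_comp
    (fun k => ∏ t, p (k.1 t, k.2 t))).symm

theorem iid_lin2 {X₁ X₂ : Type*} [Fintype X₁] [Fintype X₂] (n : ℕ) (p L : X₁ × X₂ → ℝ)
    (hp1 : ∑ a, p a = 1) :
    ∑ k : (Fin n → X₁) × (Fin n → X₂), (∏ t, p (k.1 t, k.2 t)) * ∑ t, L (k.1 t, k.2 t)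
      = n * ∑ a, p a * L a := by
  rw [← iid_lin n p L hp1]
  exact ((Equiv.arrowProdEquivProdArrow (Fin n) (fun _ => X₁) (fun _ => X₂)).sum_comp
    (fun k => (∏ t, p (k.1 t, k.2 t)) * ∑ t, L (k.1 t, k.2 t))).symm

theorem kl_lower {n : ℕ} (S : DES X₁ X₂ n) (pK g : X₁ × X₂ → ℝ)
    (hpK0 : ∀ a, 0 ≤ pK a) (hpK1 : ∑ a, pK a = 1)
    (hg : ∀ a, 0 < pK a → 0 < g a) (x : (Fin n → X₁) × (Fin n → X₂))
    (M N : ℝ) (hM : 0 < M) (hN : 0 < N)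
    (r : (Fin S.m₁ → X₁) × (Fin S.m₂ → X₂) → ℝ)
    (hr : ∀ c, 0 ≤ r c) (hr1 : ∑ c, r c ≤ 1)
    (hgr : ∀ k : (Fin n → X₁) × (Fin n → X₂),
      (∏ t, g (k.1 t, k.2 t)) / M ≤ r (S.Enc₁ k.1 x.1, S.Enc₂ k.2 x.2)) :
    Real.logb 2 N - Real.logb 2 M + n * ∑ a, pK a * Real.logb 2 (g a) ≤
      klDiv2 (condDist S pK x) (fun _ => 1 / N) := by
  have hP0 : ∀ k : (Fin n → X₁) × (Fin n → X₂), 0 ≤ ∏ t, pK (k.1 t, k.2 t) :=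
    fun k => Finset.prod_nonneg fun t _ => hpK0 _
  have hgp : ∀ k : (Fin n → X₁) × (Fin n → X₂), 0 < ∏ t, pK (k.1 t, k.2 t) →
      ∀ t, 0 < g (k.1 t, k.2 t) := by
    intro k hk t
    refine hg _ ((hpK0 _).lt_of_ne' fun h => hk.ne' (Finset.prod_eq_zero (Finset.mem_univ t) h))
  have h := push_ent (fun k : (Fin n → X₁) × (Fin n → X₂) => ∏ t, pK (k.1 t, k.2 t))
    (fun k => (S.Enc₁ k.1 x.1, S.Enc₂ k.2 x.2)) r
    (fun k => (∏ t, g (k.1 t, k.2 t)) / M) hP0 (iid_sum2 n pK hpK1) hr hr1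
    (fun k hk => div_pos (Finset.prod_pos fun t _ => hgp k hk t) hM) hgr
  have e1 : ∑ k : (Fin n → X₁) × (Fin n → X₂), (∏ t, pK (k.1 t, k.2 t)) *
      Real.logb 2 ((∏ t, g (k.1 t, k.2 t)) / M)
      = n * (∑ a, pK a * Real.logb 2 (g a)) - Real.logb 2 M := by
    rw [← iid_lin2 n pK (fun a => Real.logb 2 (g a)) hpK1]
    have e := iid_sum2 n pK hpK1
    rw [← one_mul (Real.logb 2 M), ← e, Finset.sum_mul, ← Finset.sum_sub_distrib]
    refine Finset.sum_congr rfl fun k _ => ?_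
    rcases (hP0 k).eq_or_lt with h | h
    · rw [← h]; simp
    · rw [Real.logb_div (Finset.prod_pos fun t _ => hgp k h t).ne' hM.ne',
        Real.logb_prod _ _ (fun t _ => (hgp k h t).ne')]
      ring
  have hs : ∑ c, condDist S pK x c = 1 := by
    have := push_sum (fun k : (Fin n → X₁) × (Fin n → X₂) => ∏ t, pK (k.1 t, k.2 t))
      (fun k => (S.Enc₁ k.1 x.1, S.Enc₂ k.2 x.2)) (fun _ => 1)
    simp only [mul_one] at this
    rw [iid_sum2 n pK hpK1] at this
    exact this
  have e2 : klDiv2 (condDist S pK x) (fun _ => 1 / N) =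
      ∑ c, condDist S pK x c * Real.logb 2 (condDist S pK x c) + Real.logb 2 N := by
    unfold klDiv2
    rw [← one_mul (Real.logb 2 N), ← hs, Finset.sum_mul, ← Finset.sum_add_distrib]
    refine Finset.sum_congr rfl fun c _ => ?_
    by_cases h : condDist S pK x c = 0
    · rw [h]; simp
    · rw [hs, div_div_eq_mul_div, div_one, Real.logb_mul h hN.ne']; ring
  have h' : ∑ k : (Fin n → X₁) × (Fin n → X₂), (∏ t, pK (k.1 t, k.2 t)) *
      Real.logb 2 ((∏ t, g (k.1 t, k.2 t)) / M) ≤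
      ∑ c, condDist S pK x c * Real.logb 2 (condDist S pK x c) := h
  rw [e2]; linarith

theorem delta_lower {n : ℕ} (S : DES X₁ X₂ n) (pX pK : X₁ × X₂ → ℝ)
    (hpX0 : ∀ a, 0 ≤ pX a) (hpX1 : ∑ a, pX a = 1) (B : ℝ)
    (h : ∀ x, B ≤ klDiv2 (condDist S pK x)
        (fun _ => 1 / ((Fintype.card X₁ : ℝ) ^ S.m₁ * (Fintype.card X₂ : ℝ) ^ S.m₂))) :
    B ≤ DeltaN S pX pK := by
  have hB : B = ∑ x : (Fin n → X₁) × (Fin n → X₂), (∏ t, pX (x.1 t, x.2 t)) * B := by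
    rw [← Finset.sum_mul, iid_sum2 n pX hpX1, one_mul]
  rw [hB]
  exact Finset.sum_le_sum fun x _ =>
    mul_le_mul_of_nonneg_left (h x) (Finset.prod_nonneg fun t _ => hpX0 _)

theorem push_ge {A C : Type*} [Fintype A] [DecidableEq C] (P : A → ℝ) (f : A → C)
    (hP : ∀ a, 0 ≤ P a) (a : A) : P a ≤ ∑ b, if f b = f a then P b else 0 := by
  have := Finset.single_le_sum (f := fun b => if f b = f a then P b else 0)
    (fun b _ => by split_ifs; exacts [hP b, le_rfl]) (Finset.mem_univ a)
  simpa using this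

theorem three_bounds {n : ℕ} (S : DES X₁ X₂ n) (pX pK : X₁ × X₂ → ℝ)
    (hpX0 : ∀ a, 0 ≤ pX a) (hpX1 : ∑ a, pX a = 1)
    (hpK0 : ∀ a, 0 ≤ pK a) (hpK1 : ∑ a, pK a = 1) :
    (S.m₁ * Real.logb 2 (Fintype.card X₁) ≤ n * entFst pK + DeltaN S pX pK) ∧
    (S.m₂ * Real.logb 2 (Fintype.card X₂) ≤ n * entSnd pK + DeltaN S pX pK) ∧
    (S.m₁ * Real.logb 2 (Fintype.card X₁) + S.m₂ * Real.logb 2 (Fintype.card X₂)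
      ≤ n * ent2 pK + DeltaN S pX pK) := by
  have hne : Nonempty (X₁ × X₂) := by
    by_contra h
    rw [not_nonempty_iff] at h
    simp at hpK1
  have hc1 : (0:ℝ) < Fintype.card X₁ := by
    have : Nonempty X₁ := ⟨hne.some.1⟩
    exact_mod_cast Fintype.card_pos
  have hc2 : (0:ℝ) < Fintype.card X₂ := by
    have : Nonempty X₂ := ⟨hne.some.2⟩
    exact_mod_cast Fintype.card_pos
  have hM1 : (0:ℝ) < (Fintype.card X₁ : ℝ) ^ S.m₁ := by positivity
  have hM2 : (0:ℝ) < (Fintype.card X₂ : ℝ) ^ S.m₂ := by positivity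
  have hN := mul_pos hM1 hM2
  have hlN : Real.logb 2 ((Fintype.card X₁ : ℝ) ^ S.m₁ * (Fintype.card X₂ : ℝ) ^ S.m₂) =
      S.m₁ * Real.logb 2 (Fintype.card X₁) + S.m₂ * Real.logb 2 (Fintype.card X₂) := by
    rw [Real.logb_mul hM1.ne' hM2.ne', Real.logb_pow, Real.logb_pow]
  refine ⟨?_, ?_, ?_⟩
  · have g0 : ∀ a : X₁, 0 ≤ ∑ b, pK (a, b) := fun a => Finset.sum_nonneg fun b _ => hpK0 _
    have g1 : ∑ a : X₁, ∑ b, pK (a, b) = 1 := by rw [← Fintype.sum_prod_type, hpK1]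
    have hP0 : ∀ k : Fin n → X₁, 0 ≤ ∏ t, ∑ b, pK (k t, b) :=
      fun k => Finset.prod_nonneg fun t _ => g0 _
    have hs : ∑ k : Fin n → X₁, ∏ t, ∑ b, pK (k t, b) = 1 := by
      rw [iid_sum n (fun a => ∑ b, pK (a, b)), g1, one_pow]
    have := delta_lower S pX pK hpX0 hpX1 _ (fun x => kl_lower S pK
      (fun a => ∑ b, pK (a.1, b)) hpK0 hpK1
      (fun a ha => ha.trans_le (Finset.single_le_sum (f := fun b => pK (a.1, b))
        (fun b _ => hpK0 _) (Finset.mem_univ a.2))) x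
      ((Fintype.card X₂ : ℝ) ^ S.m₂) _ hM2 hN
      (fun c => (∑ k : Fin n → X₁, if S.Enc₁ k x.1 = c.1 then ∏ t, ∑ b, pK (k t, b) else 0) /
        ((Fintype.card X₂ : ℝ) ^ S.m₂))
      (fun c => div_nonneg (Finset.sum_nonneg fun k _ => by
        split_ifs; exacts [hP0 k, le_rfl]) hM2.le)
      (by
        have h := push_sum (fun k : Fin n → X₁ => ∏ t, ∑ b, pK (k t, b))
          (fun k => S.Enc₁ k x.1) (fun _ => 1)
        simp only [mul_one, hs] at h
        rw [← Finset.sum_div, Fintype.sum_prod_type, Finset.sum_comm]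
        simp only [h]
        simp [hM2.ne'])
      (fun k => div_le_div_of_nonneg_right
        (push_ge (fun k : Fin n → X₁ => ∏ t, ∑ b, pK (k t, b)) (fun k => S.Enc₁ k x.1) hP0 k.1)
        hM2.le))
    rw [hlN, Real.logb_pow] at this
    have e : ∑ a : X₁ × X₂, pK a * Real.logb 2 (∑ b, pK (a.1, b)) = - entFst pK := by
      unfold entFst ent2
      rw [neg_neg, Fintype.sum_prod_type]
      simp [Finset.sum_mul]
    rw [e] at this
    linarith
  · have g0 : ∀ a : X₂, 0 ≤ ∑ b, pK (b, a) := fun a => Finset.sum_nonneg fun b _ => hpK0 _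
    have g1 : ∑ a : X₂, ∑ b, pK (b, a) = 1 := by rw [← Fintype.sum_prod_type_right, hpK1]
    have hP0 : ∀ k : Fin n → X₂, 0 ≤ ∏ t, ∑ b, pK (b, k t) :=
      fun k => Finset.prod_nonneg fun t _ => g0 _
    have hs : ∑ k : Fin n → X₂, ∏ t, ∑ b, pK (b, k t) = 1 := by
      rw [iid_sum n (fun a => ∑ b, pK (b, a)), g1, one_pow]
    have := delta_lower S pX pK hpX0 hpX1 _ (fun x => kl_lower S pK
      (fun a => ∑ b, pK (b, a.2)) hpK0 hpK1
      (fun a ha => ha.trans_le (Finset.single_le_sum (f := fun b => pK (b, a.2))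
        (fun b _ => hpK0 _) (Finset.mem_univ a.1))) x
      ((Fintype.card X₁ : ℝ) ^ S.m₁) _ hM1 hN
      (fun c => (∑ k : Fin n → X₂, if S.Enc₂ k x.2 = c.2 then ∏ t, ∑ b, pK (b, k t) else 0) /
        ((Fintype.card X₁ : ℝ) ^ S.m₁))
      (fun c => div_nonneg (Finset.sum_nonneg fun k _ => by
        split_ifs; exacts [hP0 k, le_rfl]) hM1.le)
      (by
        have h := push_sum (fun k : Fin n → X₂ => ∏ t, ∑ b, pK (b, k t))
          (fun k => S.Enc₂ k x.2) (fun _ => 1)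
        simp only [mul_one, hs] at h
        rw [← Finset.sum_div, Fintype.sum_prod_type]
        simp only [h]
        simp [hM1.ne'])
      (fun k => div_le_div_of_nonneg_right
        (push_ge (fun k : Fin n → X₂ => ∏ t, ∑ b, pK (b, k t)) (fun k => S.Enc₂ k x.2) hP0 k.2)
        hM1.le))
    rw [hlN, Real.logb_pow] at this
    have e : ∑ a : X₁ × X₂, pK a * Real.logb 2 (∑ b, pK (b, a.2)) = - entSnd pK := by
      unfold entSnd ent2
      rw [neg_neg, Fintype.sum_prod_type_right]
      simp [Finset.sum_mul]
    rw [e] at this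
    linarith
  · have hP0 : ∀ k : (Fin n → X₁) × (Fin n → X₂), 0 ≤ ∏ t, pK (k.1 t, k.2 t) :=
      fun k => Finset.prod_nonneg fun t _ => hpK0 _
    have := delta_lower S pX pK hpX0 hpX1 _ (fun x => kl_lower S pK pK hpK0 hpK1
      (fun a ha => ha) x 1 _ one_pos hN (condDist S pK x)
      (fun c => Finset.sum_nonneg fun k _ => by split_ifs; exacts [hP0 k, le_rfl])
      (by
        have h := push_sum (fun k : (Fin n → X₁) × (Fin n → X₂) => ∏ t, pK (k.1 t, k.2 t))
          (fun k => (S.Enc₁ k.1 x.1, S.Enc₂ k.2 x.2)) (fun _ => 1)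
        simp only [mul_one] at h
        rw [iid_sum2 n pK hpK1] at h
        exact h.le)
      (fun k => by
        rw [div_one]
        exact push_ge (fun k : (Fin n → X₁) × (Fin n → X₂) => ∏ t, pK (k.1 t, k.2 t))
          (fun k => (S.Enc₁ k.1 x.1, S.Enc₂ k.2 x.2)) hP0 k))
    rw [hlN, Real.logb_one] at this
    have e : ∑ a : X₁ × X₂, pK a * Real.logb 2 (pK a) = - ent2 pK := by
      unfold ent2; rw [neg_neg]
    rw [e] at this
    linarith

end Helpers

/-- If `(R₁,R₂)` is `(ε,δ)`-admissible, then for every `γ > 0` there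
exists `n₀` such that for all `n ≥ n₀`: `R₁ ≤ H(K₁)+γ+ε/n`, `R₂ ≤ H(K₂)+γ+ε/n`
and `R₁+R₂ ≤ H(K₁K₂)+γ+ε/n`. -/
theorem admissible_rate_key_entropy_bounds
    (pX pK : X₁ × X₂ → ℝ)
    (hpX0 : ∀ a, 0 ≤ pX a) (hpX1 : ∑ a, pX a = 1)
    (hpK0 : ∀ a, 0 ≤ pK a) (hpK1 : ∑ a, pK a = 1)
    (ε δ R₁ R₂ : ℝ)
    (hadm : Admissible pX pK ε δ R₁ R₂) :
    ∀ γ : ℝ, 0 < γ → ∃ n₀ : ℕ, ∀ n : ℕ, n₀ ≤ n →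
      R₁ ≤ entFst pK + γ + ε / (n : ℝ) ∧
      R₂ ≤ entSnd pK + γ + ε / (n : ℝ) ∧
      R₁ + R₂ ≤ ent2 pK + γ + ε / (n : ℝ) := by
  obtain ⟨S, hS⟩ := hadm
  intro γ hγ
  obtain ⟨n₀, h⟩ := hS (γ / 2) (by linarith)
  refine ⟨max n₀ 1, fun n hn => ?_⟩
  obtain ⟨⟨a1, -⟩, ⟨a2, -⟩, -, hD⟩ := h n (le_of_max_le_left hn)
  have hn1 : (0:ℝ) < n := by exact_mod_cast (le_of_max_le_right hn)
  obtain ⟨b1, b2, b3⟩ := three_bounds (S n) pX pK hpX0 hpX1 hpK0 hpK1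
  have conv : ∀ A H : ℝ, A ≤ n * H + DeltaN (S n) pX pK → A / n ≤ H + ε / n := by
    intro A H hA
    rw [div_le_iff₀ hn1, add_mul, div_mul_cancel₀ _ hn1.ne']
    linarith
  have c1 := conv _ _ b1
  have c2 := conv _ _ b2
  have c3 := conv _ _ b3
  rw [add_div] at c3
  rw [div_mul_eq_mul_div] at a1 a2
  refine ⟨by linarith, by linarith, by linarith⟩
end

section
/- (Strong converse with respect to the key region.) Fix ε₀ > 0. For every (ε,δ) ∈ (0,ε₀] × (0,1), the set R(ε,δ|p_{X₁X₂},p_{K₁K₂}) of (ε,δ)-admissible rate pairs is contained in R_key(p_{K₁K₂}) = {(R₁,R₂) : R₁ ≤ H(K₁), R₂ ≤ H(K₂), R₁ + R₂ ≤ H(K₁,K₂)}, where H(K₁), H(K₂), H(K₁,K₂) are the per-letter key entropies (base 2). -/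
variable {X₁ X₂ : Type*} [Fintype X₁] [Fintype X₂] [DecidableEq X₁] [DecidableEq X₂]

namespace SCK

noncomputable def push {α β : Type*} [Fintype α] [DecidableEq β] (f : α → β) (p : α → ℝ) (b : β) : ℝ :=
  ∑ a, if f a = b then p a else 0

noncomputable def nent {α : Type*} [Fintype α] (p : α → ℝ) : ℝ := ∑ a, p a * Real.logb 2 (p a)

lemma push_sum {α β : Type*} [Fintype α] [Fintype β] [DecidableEq β] (f : α → β) (p : α → ℝ)
    (h : β → ℝ) : ∑ b, push f p b * h b = ∑ a, p a * h (f a) := by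
  simp only [push, Finset.sum_mul, ite_mul, zero_mul]
  rw [Finset.sum_comm]
  simp

lemma push_nonneg {α β : Type*} [Fintype α] [DecidableEq β] (f : α → β) (p : α → ℝ)
    (hp : ∀ a, 0 ≤ p a) (b : β) : 0 ≤ push f p b :=
  Finset.sum_nonneg fun a _ => by split_ifs <;> simp [hp]

lemma push_total {α β : Type*} [Fintype α] [Fintype β] [DecidableEq β] (f : α → β) (p : α → ℝ) :
    ∑ b, push f p b = ∑ a, p a := by
  simpa using push_sum f p (fun _ => 1)

lemma push_comp {α β γ : Type*} [Fintype α] [Fintype β] [DecidableEq β] [DecidableEq γ]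
    (f : α → β) (g : β → γ) (p : α → ℝ) : push g (push f p) = push (fun a => g (f a)) p := by
  funext c
  have := push_sum f p (fun b => if g b = c then 1 else 0)
  simpa [push] using this

lemma le_push {α β : Type*} [Fintype α] [DecidableEq β] (f : α → β) (p : α → ℝ)
    (hp : ∀ a, 0 ≤ p a) (a : α) : p a ≤ push f p (f a) := by
  have := Finset.single_le_sum (f := fun a' => if f a' = f a then p a' else 0) (s := Finset.univ)
    (fun a' _ => by split_ifs <;> simp [hp]) (Finset.mem_univ a)
  simpa [push] using this

lemma nent_push {α β : Type*} [Fintype α] [Fintype β] [DecidableEq β] (f : α → β) (p : α → ℝ)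
    (hp : ∀ a, 0 ≤ p a) : nent p ≤ nent (push f p) := by
  unfold nent
  rw [push_sum f p (fun b => Real.logb 2 (push f p b))]
  refine Finset.sum_le_sum fun a _ => ?_
  rcases (hp a).eq_or_lt with h | h
  · simp [← h]
  · exact mul_le_mul_of_nonneg_left
      (Real.logb_le_logb_of_le (by norm_num) h (le_push f p hp a)) h.le

lemma gibbs {α : Type*} [Fintype α] (p q : α → ℝ) (hp : ∀ a, 0 ≤ p a) (hq : ∀ a, 0 ≤ q a)
    (hpq : ∀ a, 0 < p a → 0 < q a) (hs : ∑ a, q a ≤ ∑ a, p a) :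
    ∑ a, p a * Real.logb 2 (q a) ≤ nent p := by
  have key : ∑ a, (p a * Real.log (q a) - p a * Real.log (p a)) ≤ ∑ a, (q a - p a) := by
    refine Finset.sum_le_sum fun a _ => ?_
    rcases (hp a).eq_or_lt with h | h
    · simp [← h, hq a]
    · have hqa := hpq a h
      have h1 := Real.log_le_sub_one_of_pos (div_pos hqa h)
      rw [Real.log_div hqa.ne' h.ne'] at h1
      have h2 := mul_le_mul_of_nonneg_left h1 h.le
      have h3 : p a * (q a / p a - 1) = q a - p a := by field_simp
      linarith
  rw [Finset.sum_sub_distrib, Finset.sum_sub_distrib] at key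
  have h2 : 0 < Real.log 2 := Real.log_pos (by norm_num)
  simp only [nent, Real.logb, mul_div_assoc', ← Finset.sum_div]
  exact div_le_div_of_nonneg_right (by linarith) h2.le

lemma pfst {α β : Type*} [Fintype α] [Fintype β] [DecidableEq α] (p : α × β → ℝ) (a : α) :
    push Prod.fst p a = ∑ b, p (a, b) := by
  simp only [push, Fintype.sum_prod_type]
  rw [Finset.sum_comm]
  simp

lemma psnd {α β : Type*} [Fintype α] [Fintype β] [DecidableEq β] (p : α × β → ℝ) (b : β) :
    push Prod.snd p b = ∑ a, p (a, b) := by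
  simp only [push, Fintype.sum_prod_type]
  simp

lemma nent_marg {γ α : Type*} [Fintype α] [Fintype γ] [DecidableEq α] (g : γ → α)
    (q : γ → ℝ) (M : ℝ) (hM : 0 < M) (hcard : ∀ a, ((Finset.univ.filter fun c => g c = a).card : ℝ) = M)
    (hq : ∀ c, 0 ≤ q c) (hq1 : ∑ c, q c = 1) :
    nent (push g q) - Real.logb 2 M ≤ nent q := by
  have hp : ∀ c, 0 < q c → 0 < push g q (g c) := fun c h => h.trans_le (le_push g q hq c)
  have h := gibbs q (fun c => push g q (g c) / M) hq
    (fun c => div_nonneg (push_nonneg g q hq _) hM.le) (fun c h => div_pos (hp c h) hM) (by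
      apply le_of_eq
      rw [← Finset.sum_fiberwise (s := Finset.univ) (g := g)]
      rw [← push_total g q]
      refine Finset.sum_congr rfl fun a _ => ?_
      rw [Finset.sum_congr rfl (g := fun _ => push g q a / M)]
      · rw [Finset.sum_const, nsmul_eq_mul, hcard]
        field_simp
      · intro c hc
        rw [(Finset.mem_filter.1 hc).2])
  refine le_trans (le_of_eq ?_) h
  have : ∀ c, q c * Real.logb 2 (push g q (g c) / M)
      = q c * Real.logb 2 (push g q (g c)) - q c * Real.logb 2 M := by
    intro c
    rcases (hq c).eq_or_lt with h | h
    · simp [← h]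
    · rw [Real.logb_div (hp c h).ne' hM.ne', mul_sub]
  simp only [this, Finset.sum_sub_distrib, ← Finset.sum_mul, hq1, one_mul]
  rw [nent, push_sum g q (fun a => Real.logb 2 (push g q a))]

lemma sum_prod {α : Type*} [Fintype α] {n : ℕ} (g : Fin n → α → ℝ) :
    ∑ f : Fin n → α, ∏ t, g t (f t) = ∏ t, ∑ a, g t a := by
  classical
  rw [Finset.prod_univ_sum, Fintype.piFinset_univ]

lemma nent_prod {α : Type*} [Fintype α] (n : ℕ) (p : α → ℝ) (hp1 : ∑ a, p a = 1) :
    nent (fun f : Fin n → α => ∏ t, p (f t)) = n * nent p := by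
  have h1 : ∀ f : Fin n → α, (∏ t, p (f t)) * Real.logb 2 (∏ t, p (f t))
      = ∑ t, ∏ s, (if s = t then p (f s) * Real.logb 2 (p (f s)) else p (f s)) := by
    intro f
    have h2 : ∀ t, ∏ s, (if s = t then p (f s) * Real.logb 2 (p (f s)) else p (f s))
        = (∏ s, p (f s)) * Real.logb 2 (p (f t)) := by
      intro t
      rw [← Finset.mul_prod_erase _ _ (Finset.mem_univ t),
        ← Finset.mul_prod_erase _ (fun s => p (f s)) (Finset.mem_univ t)]
      rw [Finset.prod_congr rfl (g := fun s => p (f s))]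
      · simp only [if_true]; ring
      · intro s hs
        simp [(Finset.mem_erase.1 hs).1]
    simp only [h2, ← Finset.mul_sum]
    by_cases h0 : ∏ s, p (f s) = 0
    · simp [h0]
    · rw [Real.logb_prod]
      intro t _
      exact Finset.prod_ne_zero_iff.1 h0 t (Finset.mem_univ t)
  unfold nent
  simp only [h1]
  rw [Finset.sum_comm]
  have h3 : ∀ t : Fin n, ∑ f : Fin n → α, ∏ s, (if s = t then p (f s) * Real.logb 2 (p (f s)) else p (f s))
      = ∑ a, p a * Real.logb 2 (p a) := by
    intro t
    rw [sum_prod (fun s a => if s = t then p a * Real.logb 2 (p a) else p a)]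
    rw [Finset.prod_eq_single t]
    · simp
    · intro s _ hs
      simp [hs, hp1]
    · simp
  simp [h3]

lemma nent_equiv {α β : Type*} [Fintype α] [Fintype β] (e : α ≃ β) (p : β → ℝ) :
    nent (fun a => p (e a)) = nent p :=
  Equiv.sum_comp e (fun b => p b * Real.logb 2 (p b))

variable {X₁ X₂ : Type*} [Fintype X₁] [Fintype X₂] [DecidableEq X₁] [DecidableEq X₂]

def PP (n : ℕ) (p : X₁ × X₂ → ℝ) (k : (Fin n → X₁) × (Fin n → X₂)) : ℝ :=
  ∏ t, p (k.1 t, k.2 t)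

lemma PP_total (n : ℕ) (p : X₁ × X₂ → ℝ) (hp1 : ∑ a, p a = 1) : ∑ k, PP n p k = 1 := by
  rw [← Equiv.sum_comp (Equiv.arrowProdEquivProdArrow (Fin n) (fun _ => X₁) (fun _ => X₂))]
  have := sum_prod (n := n) (fun _ => p)
  simp only [hp1, Finset.prod_const_one] at this
  exact this

lemma PP_nent (n : ℕ) (p : X₁ × X₂ → ℝ) (hp1 : ∑ a, p a = 1) : nent (PP n p) = n * nent p := by
  rw [← nent_equiv (Equiv.arrowProdEquivProdArrow (Fin n) (fun _ => X₁) (fun _ => X₂))]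
  exact nent_prod n p hp1

lemma PP_fst (n : ℕ) (p : X₁ × X₂ → ℝ) :
    push Prod.fst (PP n p) = fun f => ∏ t, ∑ b, p (f t, b) := by
  funext f
  rw [pfst]
  exact sum_prod (fun t b => p (f t, b))

lemma PP_snd (n : ℕ) (p : X₁ × X₂ → ℝ) :
    push Prod.snd (PP n p) = fun f => ∏ t, ∑ a, p (a, f t) := by
  funext f
  rw [psnd]
  exact sum_prod (fun t a => p (a, f t))

lemma core {n : ℕ} (S : DES X₁ X₂ n) (pK : X₁ × X₂ → ℝ)
    (hpK0 : ∀ a, 0 ≤ pK a) (hpK1 : ∑ a, pK a = 1) (c1 : 0 < Fintype.card X₁)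
    (c2 : 0 < Fintype.card X₂) (x : (Fin n → X₁) × (Fin n → X₂)) (D : ℝ)
    (hD : klDiv2 (condDist S pK x)
        (fun _ => 1 / ((Fintype.card X₁ : ℝ) ^ S.m₁ * (Fintype.card X₂ : ℝ) ^ S.m₂)) ≤ D) :
    S.m₁ * Real.logb 2 (Fintype.card X₁) ≤ n * entFst pK + D ∧
    S.m₂ * Real.logb 2 (Fintype.card X₂) ≤ n * entSnd pK + D ∧
    S.m₁ * Real.logb 2 (Fintype.card X₁) + S.m₂ * Real.logb 2 (Fintype.card X₂)
      ≤ n * ent2 pK + D := by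
  have c1' : (0:ℝ) < Fintype.card X₁ := by exact_mod_cast c1
  have c2' : (0:ℝ) < Fintype.card X₂ := by exact_mod_cast c2
  set f : (Fin n → X₁) × (Fin n → X₂) → (Fin S.m₁ → X₁) × (Fin S.m₂ → X₂) :=
    fun k => (S.Enc₁ k.1 x.1, S.Enc₂ k.2 x.2) with hf
  have hq : condDist S pK x = push f (PP n pK) := rfl
  rw [hq] at hD
  have hP0 : ∀ k, 0 ≤ PP n pK k := fun k => Finset.prod_nonneg fun t _ => hpK0 _
  have hq0 := push_nonneg f (PP n pK) hP0
  have hq1 : ∑ c, push f (PP n pK) c = 1 := by rw [push_total, PP_total n pK hpK1]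
  set q := push f (PP n pK) with hqdef
  have hkl : klDiv2 q
        (fun _ => 1 / ((Fintype.card X₁ : ℝ) ^ S.m₁ * (Fintype.card X₂ : ℝ) ^ S.m₂))
      = nent q + (S.m₁ * Real.logb 2 (Fintype.card X₁) + S.m₂ * Real.logb 2 (Fintype.card X₂)) := by
    have : ∀ c, q c * Real.logb 2 (q c / (1 / ((Fintype.card X₁ : ℝ) ^ S.m₁ * (Fintype.card X₂ : ℝ) ^ S.m₂)))
        = q c * Real.logb 2 (q c) + q c * (S.m₁ * Real.logb 2 (Fintype.card X₁) + S.m₂ * Real.logb 2 (Fintype.card X₂)) := by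
      intro c
      rcases (hq0 c).eq_or_lt with h | h
      · simp [← h]
      · rw [div_div_eq_mul_div, div_one, Real.logb_mul h.ne' (by positivity),
          Real.logb_mul (by positivity) (by positivity), Real.logb_pow, Real.logb_pow]
        ring
    simp only [klDiv2, this, Finset.sum_add_distrib, ← Finset.sum_mul, hq1, one_mul, nent]
  rw [hkl] at hD
  have e0 : nent (PP n pK) ≤ nent q := nent_push f _ hP0
  rw [PP_nent n pK hpK1] at e0
  have e1 := nent_marg (Prod.fst) q ((Fintype.card X₂ : ℝ) ^ S.m₂) (by positivity) (by
    intro a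
    have : (Finset.univ.filter fun c : (Fin S.m₁ → X₁) × (Fin S.m₂ → X₂) => c.1 = a)
        = {a} ×ˢ Finset.univ := by
      ext c; simp [Finset.mem_product, Prod.ext_iff, eq_comm]
    rw [this]; simp) hq0 hq1
  have e2 := nent_marg (Prod.snd) q ((Fintype.card X₁ : ℝ) ^ S.m₁) (by positivity) (by
    intro a
    have : (Finset.univ.filter fun c : (Fin S.m₁ → X₁) × (Fin S.m₂ → X₂) => c.2 = a)
        = Finset.univ ×ˢ {a} := by
      ext c; simp [Finset.mem_product, Prod.ext_iff, eq_comm]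
    rw [this]; simp) hq0 hq1
  rw [Real.logb_pow] at e1 e2
  have g1 : nent (push Prod.fst (PP n pK)) ≤ nent (push Prod.fst q) := by
    have := nent_push (fun k => S.Enc₁ k x.1) _ (push_nonneg Prod.fst (PP n pK) hP0)
    rw [push_comp] at this
    rw [hqdef, push_comp]
    exact this
  have g2 : nent (push Prod.snd (PP n pK)) ≤ nent (push Prod.snd q) := by
    have := nent_push (fun k => S.Enc₂ k x.2) _ (push_nonneg Prod.snd (PP n pK) hP0)
    rw [push_comp] at this
    rw [hqdef, push_comp]
    exact this
  rw [PP_fst, nent_prod n (fun a => ∑ b, pK (a, b)) (by rw [← hpK1, Fintype.sum_prod_type])] at g1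
  rw [PP_snd, nent_prod n (fun b => ∑ a, pK (a, b)) (by rw [← hpK1, Fintype.sum_prod_type_right])] at g2
  have n1 : entFst pK = - nent (fun a => ∑ b, pK (a, b)) := rfl
  have n2 : entSnd pK = - nent (fun b => ∑ a, pK (a, b)) := rfl
  have n3 : ent2 pK = - nent pK := rfl
  rw [n1, n2, n3]
  refine ⟨?_, ?_, ?_⟩ <;> linarith

lemma exists_x {n : ℕ} (S : DES X₁ X₂ n) (pX pK : X₁ × X₂ → ℝ)
    (hpX0 : ∀ a, 0 ≤ pX a) (hpX1 : ∑ a, pX a = 1) (ε : ℝ) (h : DeltaN S pX pK ≤ ε) :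
    ∃ x, klDiv2 (condDist S pK x)
        (fun _ => 1 / ((Fintype.card X₁ : ℝ) ^ S.m₁ * (Fintype.card X₂ : ℝ) ^ S.m₂)) ≤ ε := by
  by_contra! hc
  have h1 := PP_total n pX hpX1
  have hP0 : ∀ k, 0 ≤ PP n pX k := fun k => Finset.prod_nonneg fun t _ => hpX0 _
  obtain ⟨k, -, hk⟩ := Finset.exists_ne_zero_of_sum_ne_zero (h1.trans_ne one_ne_zero)
  have : ∑ k, PP n pX k * ε < DeltaN S pX pK := by
    refine Finset.sum_lt_sum (fun x _ => mul_le_mul_of_nonneg_left (hc x).le (hP0 x))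
      ⟨k, Finset.mem_univ k, mul_lt_mul_of_pos_left (hc k) ((hP0 k).lt_of_ne' hk)⟩
  rw [← Finset.sum_mul, h1] at this
  linarith

lemma fin_bound {H L ε γ : ℝ} {n : ℕ} (hn : 0 < n) (hnε : ε / γ ≤ n) (hγ : 0 < γ)
    (h : L ≤ n * H + ε) : L / n ≤ H + γ := by
  have hn' : (0:ℝ) < n := by exact_mod_cast hn
  rw [div_le_iff₀ hn']
  rw [div_le_iff₀ hγ] at hnε
  linarith

end SCK

/-- strong converse, key region: for every
`(ε,δ) ∈ (0,ε₀] × (0,1)`, any `(ε,δ)`-admissible rate pair lies in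
`R_key(p_{K₁K₂}) = {(R₁,R₂) : R₁ ≤ H(K₁), R₂ ≤ H(K₂), R₁+R₂ ≤ H(K₁K₂)}`. -/
theorem strong_converse_key_region
    (ε₀ : ℝ) (hε₀ : 0 < ε₀)
    (pX pK : X₁ × X₂ → ℝ)
    (hpX0 : ∀ a, 0 ≤ pX a) (hpX1 : ∑ a, pX a = 1)
    (hpK0 : ∀ a, 0 ≤ pK a) (hpK1 : ∑ a, pK a = 1)
    (ε δ : ℝ) (hε : 0 < ε) (hεle : ε ≤ ε₀) (hδ0 : 0 < δ) (hδ1 : δ < 1)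
    (R₁ R₂ : ℝ) (hadm : Admissible pX pK ε δ R₁ R₂) :
    R₁ ≤ entFst pK ∧ R₂ ≤ entSnd pK ∧ R₁ + R₂ ≤ ent2 pK := by
  obtain ⟨S, hS⟩ := hadm
  obtain ⟨a0, -, -⟩ := Finset.exists_ne_zero_of_sum_ne_zero (hpX1.trans_ne one_ne_zero)
  have c1 : 0 < Fintype.card X₁ := Fintype.card_pos_iff.2 ⟨a0.1⟩
  have c2 : 0 < Fintype.card X₂ := Fintype.card_pos_iff.2 ⟨a0.2⟩
  have main : ∀ γ : ℝ, 0 < γ → R₁ ≤ entFst pK + 3 * γ ∧ R₂ ≤ entSnd pK + 3 * γ ∧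
      R₁ + R₂ ≤ ent2 pK + 3 * γ := by
    intro γ hγ
    obtain ⟨n₀, hn₀⟩ := hS γ hγ
    set n := max (max n₀ 1) ⌈ε / γ⌉₊ with hn
    have h0 : n₀ ≤ n := (le_max_left _ _).trans (le_max_left _ _)
    have h1 : 0 < n := Nat.lt_of_lt_of_le Nat.one_pos ((le_max_right _ _).trans (le_max_left _ _))
    have h2 : ε / γ ≤ n := (Nat.le_ceil _).trans (by exact_mod_cast le_max_right _ _)
    obtain ⟨⟨r1, -⟩, ⟨r2, -⟩, -, hD⟩ := hn₀ n h0
    obtain ⟨x, hx⟩ := SCK.exists_x (S n) pX pK hpX0 hpX1 ε hD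
    obtain ⟨k1, k2, k3⟩ := SCK.core (S n) pK hpK0 hpK1 c1 c2 x ε hx
    have b1 := SCK.fin_bound h1 h2 hγ k1
    have b2 := SCK.fin_bound h1 h2 hγ k2
    have b3 := SCK.fin_bound h1 h2 hγ k3
    rw [add_div] at b3
    rw [div_mul_eq_mul_div] at r1 r2
    refine ⟨?_, ?_, ?_⟩ <;> linarith
  refine ⟨?_, ?_, ?_⟩ <;> refine le_of_forall_pos_le_add fun γ hγ => ?_
  · have := (main (γ / 3) (by positivity)).1
    linarith
  · have := (main (γ / 3) (by positivity)).2.1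
    linarith
  · have := (main (γ / 3) (by positivity)).2.2
    linarith
end

section
/- (Strong converse with respect to the Slepian–Wolf region.) Fix ε₀ > 0. For every (ε,δ) ∈ (0,ε₀] × (0,1), the set R(ε,δ|p_{X₁X₂},p_{K₁K₂}) of (ε,δ)-admissible rate pairs is contained in R_sw(p_{X₁X₂}) = {(R₁,R₂) : R₁ ≥ H(X₁|X₂), R₂ ≥ H(X₂|X₁), R₁ + R₂ ≥ H(X₁,X₂)}, where H(X₁|X₂), H(X₂|X₁) are the per-letter conditional source entropies and H(X₁,X₂) the per-letter joint source entropy (base 2). -/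
variable {X₁ X₂ : Type*} [Fintype X₁] [Fintype X₂] [DecidableEq X₁] [DecidableEq X₂]

theorem sw_base {α : Type*} [Fintype α] (p f : α → ℝ) (hp0 : ∀ a, 0 ≤ p a)
    (hp1 : ∑ a, p a = 1) (hf : ∑ a, p a * f a < 0) :
    ∃ s : ℝ, 0 < s ∧ ∑ a, p a * Real.exp (s * f a) < 1 := by
  have hd : HasDerivAt (fun s : ℝ => ∑ a, p a * Real.exp (s * f a)) (∑ a, p a * f a) 0 := by
    have : ∀ a ∈ (Finset.univ : Finset α),
        HasDerivAt (fun s : ℝ => p a * Real.exp (s * f a)) (p a * f a) 0 := by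
      intro a _
      have h1 : HasDerivAt (fun s : ℝ => s * f a) (f a) 0 := by
        simpa using (hasDerivAt_id (0 : ℝ)).mul_const (f a)
      simpa using (h1.exp).const_mul (p a)
    simpa using HasDerivAt.fun_sum this
  have h := (hasDerivAt_iff_tendsto_slope.1 hd).eventually (gt_mem_nhds hf)
  have h2 : ∀ᶠ s in nhdsWithin (0 : ℝ) (Set.Ioi 0),
      slope (fun s : ℝ => ∑ a, p a * Real.exp (s * f a)) 0 s < 0 :=
    h.filter_mono (nhdsWithin_mono _ (by intro x hx; exact ne_of_gt hx))
  obtain ⟨s, hs, hs0⟩ := (h2.and self_mem_nhdsWithin).exists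
  refine ⟨s, hs0, ?_⟩
  have hs0' : (0 : ℝ) < s := hs0
  rw [slope_def_field] at hs
  simp only [zero_mul, Real.exp_zero, mul_one, hp1, sub_zero] at hs
  have := (div_neg_iff.1 hs)
  rcases this with h | h <;> linarith [h.1, h.2]

theorem sw_point {α : Type*} (p w : α → ℝ) (hp0 : ∀ a, 0 ≤ p a)
    (hw0 : ∀ a, 0 ≤ w a) (hpw : ∀ a, p a ≠ 0 → 0 < w a) (c s : ℝ) (hs : 0 < s)
    (n : ℕ) (x : Fin n → α) :
    ∏ t, p (x t) ≤ (∏ t, w (x t)) * Real.exp (-(n * c)) +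
      ∏ t, p (x t) * Real.exp (s * (Real.log (p (x t) / w (x t)) + c)) := by
  have hW : 0 ≤ ∏ t, w (x t) := Finset.prod_nonneg fun _ _ => hw0 _
  have hP : 0 ≤ ∏ t, p (x t) := Finset.prod_nonneg fun _ _ => hp0 _
  rw [Finset.prod_mul_distrib, ← Real.exp_sum, ← Finset.mul_sum]
  by_cases h : 0 ≤ ∑ t, (Real.log (p (x t) / w (x t)) + c)
  · have : 1 ≤ Real.exp (s * ∑ t, (Real.log (p (x t) / w (x t)) + c)) :=
      Real.one_le_exp (by positivity)
    have h1 := le_mul_of_one_le_right hP this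
    have : 0 ≤ (∏ t, w (x t)) * Real.exp (-(n * c)) := by positivity
    linarith
  · have h3 : 0 ≤ (∏ t, p (x t)) *
      Real.exp (s * ∑ t, (Real.log (p (x t) / w (x t)) + c)) := by positivity
    suffices ∏ t, p (x t) ≤ (∏ t, w (x t)) * Real.exp (-(n * c)) by linarith
    by_cases hz : ∃ t, p (x t) = 0
    · obtain ⟨t, ht⟩ := hz
      rw [Finset.prod_eq_zero (Finset.mem_univ t) ht]; positivity
    · push Not at hz h
      rw [Finset.sum_add_distrib] at h
      simp only [Finset.sum_const, Finset.card_univ, Fintype.card_fin, nsmul_eq_mul] at h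
      have : ∏ t, p (x t) = (∏ t, w (x t)) * Real.exp (∑ t, Real.log (p (x t) / w (x t))) := by
        rw [Real.exp_sum, ← Finset.prod_mul_distrib]
        refine Finset.prod_congr rfl fun t _ => ?_
        have h1 := hpw _ (hz t)
        have h2 := lt_of_le_of_ne (hp0 (x t)) (Ne.symm (hz t))
        rw [Real.exp_log (by positivity)]
        field_simp
      rw [this]
      gcongr
      linarith

theorem sw_sum_prod {α : Type*} [Fintype α] (f : α → ℝ) (n : ℕ) :
    ∑ x : Fin n → α, ∏ t, f (x t) = (∑ a, f a) ^ n := by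
  classical
  have := Finset.prod_univ_sum (fun _ : Fin n => (Finset.univ : Finset α)) (fun _ a => f a)
  simpa using this.symm

theorem sw_key {α : Type*} [Fintype α] (p w : α → ℝ) (hp0 : ∀ a, 0 ≤ p a)
    (hp1 : ∑ a, p a = 1)
    (hw0 : ∀ a, 0 ≤ w a) (hpw : ∀ a, p a ≠ 0 → 0 < w a) (δ r : ℝ) (hδ : δ < 1)
    (hr : r < - ∑ a, p a * Real.log (p a / w a)) :
    ∃ n₀ : ℕ, ∀ n ≥ n₀, ∀ D : Finset (Fin n → α),
      ∑ x ∈ D, ∏ t, w (x t) ≤ Real.exp (n * r) → ∑ x ∈ D, ∏ t, p (x t) < 1 - δ := by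
  obtain ⟨c, hc1, hc2⟩ := exists_between hr
  obtain ⟨s, hs, hρ⟩ := sw_base p (fun a => Real.log (p a / w a) + c) hp0 hp1 (by
    simp only [mul_add, Finset.sum_add_distrib, ← Finset.sum_mul, hp1]; linarith)
  set ρ := ∑ a, p a * Real.exp (s * (Real.log (p a / w a) + c)) with hρd
  have hρ0 : 0 ≤ ρ := Finset.sum_nonneg fun a _ => mul_nonneg (hp0 a) (Real.exp_pos _).le
  have t1 := tendsto_pow_atTop_nhds_zero_of_lt_one hρ0 hρ
  have t2 := tendsto_pow_atTop_nhds_zero_of_lt_one (Real.exp_pos (r - c)).le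
    (Real.exp_lt_one_iff.2 (by linarith))
  have t3 := t2.add t1
  rw [add_zero] at t3
  have := t3.eventually (gt_mem_nhds (show (0 : ℝ) < 1 - δ by linarith))
  obtain ⟨n₀, hn₀⟩ := Filter.eventually_atTop.1 this
  refine ⟨n₀, fun n hn D hD => lt_of_le_of_lt ?_ (hn₀ n hn)⟩
  calc ∑ x ∈ D, ∏ t, p (x t) ≤ ∑ x ∈ D, ((∏ t, w (x t)) * Real.exp (-(n * c)) +
      ∏ t, p (x t) * Real.exp (s * (Real.log (p (x t) / w (x t)) + c))) :=
        Finset.sum_le_sum fun x _ => sw_point p w hp0 hw0 hpw c s hs n x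
    _ ≤ Real.exp (n * r) * Real.exp (-(n * c)) + ρ ^ n := by
        rw [Finset.sum_add_distrib, ← Finset.sum_mul, hρd, ← sw_sum_prod]
        refine add_le_add (by gcongr) ?_
        exact Finset.sum_le_sum_of_subset_of_nonneg (Finset.subset_univ _)
          fun x _ _ => Finset.prod_nonneg fun _ _ => mul_nonneg (hp0 _) (Real.exp_pos _).le
    _ = _ := by
        rw [← Real.exp_add, ← Real.exp_nat_mul]; ring_nf

theorem sw_sum_inj {β γ : Type*} [Fintype γ] (D : Finset β) (F : β → ℝ) (G : γ → ℝ)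
    (g : β → γ) (hg : Set.InjOn g D) (hG : ∀ c, 0 ≤ G c) (hFG : ∀ x, F x = G (g x)) :
    ∑ x ∈ D, F x ≤ ∑ c, G c := by
  classical
  calc ∑ x ∈ D, F x = ∑ c ∈ D.image g, G c := by
        rw [Finset.sum_image hg]; exact Finset.sum_congr rfl fun x _ => hFG x
    _ ≤ _ := Finset.sum_le_sum_of_subset_of_nonneg (Finset.subset_univ _) fun c _ _ => hG c

/-- The set of correctly decoded source sequences. -/
def swGood {n : ℕ} (S : DES X₁ X₂ n) : Finset (Fin n → X₁ × X₂) :=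
  Finset.univ.filter fun x => S.dec (S.enc₁ (fun t => (x t).1), S.enc₂ (fun t => (x t).2)) =
    (fun t => (x t).1, fun t => (x t).2)

theorem sw_good_prob {n : ℕ} (S : DES X₁ X₂ n) (pX : X₁ × X₂ → ℝ) (h1 : ∑ a, pX a = 1) :
    ∑ x ∈ swGood S, ∏ t, pX (x t) = 1 - pErr S pX := by
  have h : pErr S pX = ∑ x : Fin n → X₁ × X₂, if S.dec (S.enc₁ (fun t => (x t).1),
      S.enc₂ (fun t => (x t).2)) ≠ (fun t => (x t).1, fun t => (x t).2) then
      ∏ t, pX (x t) else 0 := by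
    unfold pErr
    exact ((Equiv.arrowProdEquivProdArrow (Fin n) (fun _ => X₁) (fun _ => X₂)).sum_comp
      (fun x => if S.dec (S.enc₁ x.1, S.enc₂ x.2) ≠ x then
        ∏ t, pX (x.1 t, x.2 t) else 0)).symm
  have h2 := sw_sum_prod pX n
  rw [h1, one_pow] at h2
  rw [h, ← h2, swGood, Finset.sum_filter, ← Finset.sum_sub_distrib]
  refine Finset.sum_congr rfl fun x _ => ?_
  split_ifs <;> simp_all

theorem sw_good_inj {n : ℕ} (S : DES X₁ X₂ n) {x y : Fin n → X₁ × X₂}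
    (hx : x ∈ swGood S) (hy : y ∈ swGood S)
    (h1 : S.enc₁ (fun t => (x t).1) = S.enc₁ (fun t => (y t).1))
    (h2 : S.enc₂ (fun t => (x t).2) = S.enc₂ (fun t => (y t).2)) : x = y := by
  simp only [swGood, Finset.mem_filter, Finset.mem_univ, true_and] at hx hy
  rw [h1, h2, hy] at hx
  have e1 := (Prod.ext_iff.1 hx).1
  have e2 := (Prod.ext_iff.1 hx).2
  funext t
  exact Prod.ext (congrFun e1 t).symm (congrFun e2 t).symm

theorem sw_sum1 {n : ℕ} (S : DES X₁ X₂ n) :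
    ∑ x ∈ swGood S, ∏ t, (fun _ : X₁ × X₂ => (1 : ℝ)) (x t) ≤
      (Fintype.card X₁ : ℝ) ^ S.m₁ * (Fintype.card X₂ : ℝ) ^ S.m₂ := by
  refine (sw_sum_inj (swGood S) _ (fun _ : (Fin S.m₁ → X₁) × (Fin S.m₂ → X₂) => (1 : ℝ))
    (fun x => (S.enc₁ (fun t => (x t).1), S.enc₂ (fun t => (x t).2))) ?_ ?_ ?_).trans ?_
  · intro x hx y hy h
    exact sw_good_inj S hx hy (Prod.ext_iff.1 h).1 (Prod.ext_iff.1 h).2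
  · intro c; exact zero_le_one
  · intro x; simp
  · simp

theorem sw_sum2 {n : ℕ} (S : DES X₁ X₂ n) (q : X₂ → ℝ) (hq : ∀ b, 0 ≤ q b)
    (hq1 : ∑ b, q b = 1) :
    ∑ x ∈ swGood S, ∏ t, (fun a : X₁ × X₂ => q a.2) (x t) ≤ (Fintype.card X₁ : ℝ) ^ S.m₁ := by
  refine (sw_sum_inj (swGood S) _
    (fun c : (Fin S.m₁ → X₁) × (Fin n → X₂) => ∏ t, q (c.2 t))
    (fun x => (S.enc₁ (fun t => (x t).1), fun t => (x t).2)) ?_ ?_ ?_).trans ?_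
  · intro x hx y hy h
    exact sw_good_inj S hx hy (Prod.ext_iff.1 h).1 (congrArg S.enc₂ (Prod.ext_iff.1 h).2)
  · intro c; exact Finset.prod_nonneg fun _ _ => hq _
  · intro x; rfl
  · rw [Fintype.sum_prod_type]
    simp only [sw_sum_prod, hq1]
    simp

theorem sw_sum3 {n : ℕ} (S : DES X₁ X₂ n) (q : X₁ → ℝ) (hq : ∀ b, 0 ≤ q b)
    (hq1 : ∑ b, q b = 1) :
    ∑ x ∈ swGood S, ∏ t, (fun a : X₁ × X₂ => q a.1) (x t) ≤ (Fintype.card X₂ : ℝ) ^ S.m₂ := by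
  refine (sw_sum_inj (swGood S) _
    (fun c : (Fin n → X₁) × (Fin S.m₂ → X₂) => ∏ t, q (c.1 t))
    (fun x => (fun t => (x t).1, S.enc₂ (fun t => (x t).2))) ?_ ?_ ?_).trans ?_
  · intro x hx y hy h
    exact sw_good_inj S hx hy (congrArg S.enc₁ (Prod.ext_iff.1 h).1) (Prod.ext_iff.1 h).2
  · intro c; exact Finset.prod_nonneg fun _ _ => hq _
  · intro x; rfl
  · rw [Fintype.sum_prod_type_right]
    simp only [sw_sum_prod, hq1]
    simp

theorem sw_rate {n m k : ℕ} (hn : 0 < n) (hk : 0 < k) {R : ℝ}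
    (h : (m : ℝ) / n * Real.logb 2 k ≤ R) : (k : ℝ) ^ m ≤ Real.exp (n * (R * Real.log 2)) := by
  have hk' : (0 : ℝ) < k := by exact_mod_cast hk
  have hn' : (0 : ℝ) < n := by exact_mod_cast hn
  have h2 : 0 < Real.log 2 := Real.log_pos (by norm_num)
  rw [← Real.log_le_iff_le_exp (by positivity), Real.log_pow]
  have e : (m : ℝ) * Real.log k = n * ((m : ℝ) / n * Real.logb 2 k * Real.log 2) := by
    unfold Real.logb; field_simp
  rw [e]
  gcongr

theorem sw_ent {α : Type*} [Fintype α] (p w : α → ℝ) (hpw : ∀ a, p a ≠ 0 → 0 < w a) :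
    - ∑ a, p a * Real.log (p a / w a) =
      (ent2 p + ∑ a, p a * Real.logb 2 (w a)) * Real.log 2 := by
  have h2 : 0 < Real.log 2 := Real.log_pos (by norm_num)
  unfold ent2
  rw [← Finset.sum_neg_distrib, ← Finset.sum_neg_distrib, ← Finset.sum_add_distrib,
    Finset.sum_mul]
  refine Finset.sum_congr rfl fun a _ => ?_
  by_cases h : p a = 0
  · simp [h]
  · rw [Real.log_div h (hpw a h).ne']
    unfold Real.logb
    field_simp
    ring

/-- Abstract converse: a bound on the weighted size gives a bound on the rate. -/
theorem sw_conv (pX : X₁ × X₂ → ℝ) (hpX0 : ∀ a, 0 ≤ pX a) (hpX1 : ∑ a, pX a = 1)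
    (w : X₁ × X₂ → ℝ) (hw0 : ∀ a, 0 ≤ w a) (hpw : ∀ a, pX a ≠ 0 → 0 < w a)
    (δ R : ℝ) (hδ : δ < 1) (S : (n : ℕ) → DES X₁ X₂ n)
    (h : ∀ γ : ℝ, 0 < γ → ∃ n₀ : ℕ, ∀ n ≥ n₀, pErr (S n) pX ≤ δ ∧
      ∑ x ∈ swGood (S n), ∏ t, w (x t) ≤ Real.exp (n * ((R + γ) * Real.log 2))) :
    ent2 pX + ∑ a, pX a * Real.logb 2 (w a) ≤ R := by
  by_contra! hlt
  have h2 : 0 < Real.log 2 := Real.log_pos (by norm_num)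
  obtain ⟨R', hR1, hR2⟩ := exists_between hlt
  obtain ⟨n₁, hn₁⟩ := sw_key pX w hpX0 hpX1 hw0 hpw δ (R' * Real.log 2) hδ (by
    rw [sw_ent pX w hpw]; gcongr)
  obtain ⟨n₂, hn₂⟩ := h (R' - R) (by linarith)
  obtain ⟨ha, hb⟩ := hn₂ (max n₁ n₂) (le_max_right _ _)
  have := hn₁ (max n₁ n₂) (le_max_left _ _) (swGood (S _)) (by
    rw [add_sub_cancel] at hb; exact hb)
  rw [sw_good_prob _ _ hpX1] at this
  linarith

/-- strong converse, Slepian–Wolf region: for every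
`(ε,δ) ∈ (0,ε₀] × (0,1)`, any `(ε,δ)`-admissible rate pair lies in
`R_sw(p_{X₁X₂}) = {(R₁,R₂) : R₁ ≥ H(X₁|X₂), R₂ ≥ H(X₂|X₁), R₁+R₂ ≥ H(X₁X₂)}`,
where `H(X₁|X₂) = H(X₁X₂) − H(X₂)` and `H(X₂|X₁) = H(X₁X₂) − H(X₁)`. -/
theorem strong_converse_slepian_wolf_region
    (ε₀ : ℝ) (hε₀ : 0 < ε₀)
    (pX pK : X₁ × X₂ → ℝ)
    (hpX0 : ∀ a, 0 ≤ pX a) (hpX1 : ∑ a, pX a = 1)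
    (hpK0 : ∀ a, 0 ≤ pK a) (hpK1 : ∑ a, pK a = 1)
    (ε δ : ℝ) (hε : 0 < ε) (hεle : ε ≤ ε₀) (hδ0 : 0 < δ) (hδ1 : δ < 1)
    (R₁ R₂ : ℝ) (hadm : Admissible pX pK ε δ R₁ R₂) :
    ent2 pX - entSnd pX ≤ R₁ ∧ ent2 pX - entFst pX ≤ R₂ ∧ ent2 pX ≤ R₁ + R₂ := by
  obtain ⟨S, hS⟩ := hadm
  have hne : Nonempty (X₁ × X₂) := by
    by_contra hc
    rw [not_nonempty_iff] at hc
    simp at hpX1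
  obtain ⟨a₁, a₂⟩ := hne
  have hc1 : 0 < Fintype.card X₁ := Fintype.card_pos_iff.2 ⟨a₁⟩
  have hc2 : 0 < Fintype.card X₂ := Fintype.card_pos_iff.2 ⟨a₂⟩
  refine ⟨?_, ?_, ?_⟩
  · have hq0 : ∀ b, 0 ≤ ∑ a, pX (a, b) := fun b => Finset.sum_nonneg fun a _ => hpX0 _
    have := sw_conv pX hpX0 hpX1 (fun a => ∑ a', pX (a', a.2)) (fun a => hq0 _) (fun a ha =>
      lt_of_lt_of_le (lt_of_le_of_ne (hpX0 a) (Ne.symm ha))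
        (Finset.single_le_sum (f := fun a' => pX (a', a.2)) (fun i _ => hpX0 _)
          (Finset.mem_univ a.1))) δ R₁ hδ1 S (fun γ hγ => by
        obtain ⟨n₀, hn₀⟩ := hS γ hγ
        refine ⟨max n₀ 1, fun n hn => ?_⟩
        obtain ⟨h1, h2, h3, h4⟩ := hn₀ n ((le_max_left _ _).trans hn)
        have hn1 : 0 < n := (le_max_right n₀ 1).trans hn
        refine ⟨h3, (sw_sum2 (S n) (fun b => ∑ a, pX (a, b)) hq0 ?_).trans
          (sw_rate hn1 hc1 h1.2)⟩
        rw [← hpX1, Fintype.sum_prod_type_right])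
    have e : ∑ a, pX a * Real.logb 2 (∑ a', pX (a', a.2)) = - entSnd pX := by
      unfold entSnd ent2
      rw [Fintype.sum_prod_type_right, neg_neg]
      simp only [Finset.sum_mul]
    simp only [e] at this
    linarith
  · have hq0 : ∀ a, 0 ≤ ∑ b, pX (a, b) := fun b => Finset.sum_nonneg fun a _ => hpX0 _
    have := sw_conv pX hpX0 hpX1 (fun a => ∑ b, pX (a.1, b)) (fun a => hq0 _) (fun a ha =>
      lt_of_lt_of_le (lt_of_le_of_ne (hpX0 a) (Ne.symm ha))
        (Finset.single_le_sum (f := fun b => pX (a.1, b)) (fun i _ => hpX0 _)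
          (Finset.mem_univ a.2))) δ R₂ hδ1 S (fun γ hγ => by
        obtain ⟨n₀, hn₀⟩ := hS γ hγ
        refine ⟨max n₀ 1, fun n hn => ?_⟩
        obtain ⟨h1, h2, h3, h4⟩ := hn₀ n ((le_max_left _ _).trans hn)
        have hn1 : 0 < n := (le_max_right n₀ 1).trans hn
        refine ⟨h3, (sw_sum3 (S n) (fun a => ∑ b, pX (a, b)) hq0 ?_).trans
          (sw_rate hn1 hc2 h2.2)⟩
        rw [← hpX1, Fintype.sum_prod_type])
    have e : ∑ a, pX a * Real.logb 2 (∑ b, pX (a.1, b)) = - entFst pX := by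
      unfold entFst ent2
      rw [Fintype.sum_prod_type, neg_neg]
      simp only [Finset.sum_mul]
    simp only [e] at this
    linarith
  · have := sw_conv pX hpX0 hpX1 (fun _ => 1) (fun a => zero_le_one) (fun a ha => one_pos)
      δ (R₁ + R₂) hδ1 S (fun γ hγ => by
        obtain ⟨n₀, hn₀⟩ := hS (γ / 2) (by positivity)
        refine ⟨max n₀ 1, fun n hn => ?_⟩
        obtain ⟨h1, h2, h3, h4⟩ := hn₀ n ((le_max_left _ _).trans hn)
        have hn1 : 0 < n := (le_max_right n₀ 1).trans hn
        refine ⟨h3, (sw_sum1 (S n)).trans ?_⟩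
        refine (mul_le_mul (sw_rate hn1 hc1 h1.2) (sw_rate hn1 hc2 h2.2) (by positivity)
          (Real.exp_pos _).le).trans (le_of_eq ?_)
        rw [← Real.exp_add]; ring_nf)
    simpa using this
end

section
/- (Security reduces to key flattening for the affine scheme.) Let Φᵢ(kᵢ,xᵢ) = (xᵢ ⊕ kᵢ)Aᵢ ⊕ bᵢ^{mᵢ} and suppose the key pair (𝐊₁,𝐊₂) is independent of the source pair (𝐗₁,𝐗₂). Then the security measure satisfies Δ = m₁·log|X₁| + m₂·log|X₂| − H(K̃₁, K̃₂) = D(law of (K̃₁, K̃₂) ‖ u), where K̃ᵢ = 𝐊ᵢAᵢ ⊕ bᵢ^{mᵢ} are the compressed keys, u is the uniform distribution on X₁^{m₁} × X₂^{m₂}, H is Shannon entropy and D the Kullback–Leibler divergence (logarithms base 2). -/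
/-- security reduces to key flattening for the affine scheme:
with `Φᵢ(kᵢ,xᵢ) = (xᵢ ⊕ kᵢ)Aᵢ ⊕ bᵢ` and keys independent of sources,
`Δ = m₁·log|X₁| + m₂·log|X₂| − H(K̃₁,K̃₂) = D(law of (K̃₁,K̃₂) ‖ u)`,
where `K̃ᵢ = 𝐊ᵢAᵢ ⊕ bᵢ` are the compressed keys. -/
theorem affine_scheme_Delta_eq_key_flattening
    (X₁ X₂ : Type*) [Field X₁] [Field X₂] [Fintype X₁] [Fintype X₂]
    [DecidableEq X₁] [DecidableEq X₂]
    (n m₁ m₂ : ℕ) (hn : 0 < n) (hm₁ : 0 < m₁) (hm₂ : 0 < m₂)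
    (A₁ : Matrix (Fin n) (Fin m₁) X₁) (A₂ : Matrix (Fin n) (Fin m₂) X₂)
    (b₁ : Fin m₁ → X₁) (b₂ : Fin m₂ → X₂)
    (Φ₁ : (Fin n → X₁) → (Fin n → X₁) → Fin m₁ → X₁)
    (hΦ₁ : ∀ k₁ x₁, Φ₁ k₁ x₁ = Matrix.vecMul (x₁ + k₁) A₁ + b₁)
    (Φ₂ : (Fin n → X₂) → (Fin n → X₂) → Fin m₂ → X₂)
    (hΦ₂ : ∀ k₂ x₂, Φ₂ k₂ x₂ = Matrix.vecMul (x₂ + k₂) A₂ + b₂)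
    -- `q` : joint key distribution, `p` : joint source distribution (independent of keys)
    (q : (Fin n → X₁) × (Fin n → X₂) → ℝ)
    (hq0 : ∀ k, 0 ≤ q k) (hq1 : ∑ k, q k = 1)
    (p : (Fin n → X₁) × (Fin n → X₂) → ℝ)
    (hp0 : ∀ x, 0 ≤ p x) (hp1 : ∑ x, p x = 1)
    -- conditional distribution of the ciphertext pair given the plaintext pair
    (cond : (Fin n → X₁) × (Fin n → X₂) → (Fin m₁ → X₁) × (Fin m₂ → X₂) → ℝ)
    (hcond : ∀ x c, cond x c =
      ∑ k : (Fin n → X₁) × (Fin n → X₂),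
        (if (Φ₁ k.1 x.1, Φ₂ k.2 x.2) = c then q k else 0))
    -- law of the compressed key pair (K̃₁, K̃₂) = (𝐊₁A₁ ⊕ b₁, 𝐊₂A₂ ⊕ b₂)
    (lawK : (Fin m₁ → X₁) × (Fin m₂ → X₂) → ℝ)
    (hlawK : ∀ c, lawK c =
      ∑ k : (Fin n → X₁) × (Fin n → X₂),
        (if (Matrix.vecMul k.1 A₁ + b₁, Matrix.vecMul k.2 A₂ + b₂) = c then q k else 0))
    -- uniform distribution on the ciphertext space
    (u : (Fin m₁ → X₁) × (Fin m₂ → X₂) → ℝ)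
    (hu : ∀ c, u c = 1 / ((Fintype.card X₁ : ℝ) ^ m₁ * (Fintype.card X₂ : ℝ) ^ m₂))
    (Δ : ℝ)
    (hΔ : Δ = ∑ x, p x * klDiv2 (cond x) u) :
    Δ = (m₁ : ℝ) * Real.logb 2 (Fintype.card X₁)
        + (m₂ : ℝ) * Real.logb 2 (Fintype.card X₂) - ent2 lawK ∧
    Δ = klDiv2 lawK u := by
  have hkl : klDiv2 lawK u = (m₁ : ℝ) * Real.logb 2 (Fintype.card X₁)
        + (m₂ : ℝ) * Real.logb 2 (Fintype.card X₂) - ent2 lawK := by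
    have hc1 : (Fintype.card X₁ : ℝ) ≠ 0 := by exact_mod_cast Fintype.card_ne_zero
    have hc2 : (Fintype.card X₂ : ℝ) ≠ 0 := by exact_mod_cast Fintype.card_ne_zero
    have hsum : ∑ c, lawK c = 1 := by
      simp only [hlawK]
      rw [Finset.sum_comm]
      simpa using hq1
    have hterm : ∀ c, lawK c * Real.logb 2 (lawK c / u c) =
        lawK c * ((m₁ : ℝ) * Real.logb 2 (Fintype.card X₁)
        + (m₂ : ℝ) * Real.logb 2 (Fintype.card X₂)) + lawK c * Real.logb 2 (lawK c) := by
      intro c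
      by_cases h : lawK c = 0
      · simp [h]
      · rw [hu, div_div_eq_mul_div, div_one, Real.logb_mul h (by positivity),
          Real.logb_mul (by positivity) (by positivity), Real.logb_pow, Real.logb_pow]
        ring
    unfold klDiv2 ent2
    rw [Finset.sum_congr rfl (fun c _ => hterm c), Finset.sum_add_distrib, ← Finset.sum_mul, hsum]
    ring
  have hx : ∀ x, klDiv2 (cond x) u = klDiv2 lawK u := by
    intro x
    unfold klDiv2
    refine (Fintype.sum_equiv
      (Equiv.addLeft (Matrix.vecMul x.1 A₁, Matrix.vecMul x.2 A₂)) _ _ ?_).symm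
    intro c
    have hc : cond x (Equiv.addLeft (Matrix.vecMul x.1 A₁, Matrix.vecMul x.2 A₂) c)
        = lawK c := by
      rw [hcond, hlawK]
      refine Finset.sum_congr rfl fun k _ => ?_
      refine if_congr ?_ rfl rfl
      simp only [hΦ₁, hΦ₂, Matrix.add_vecMul, Equiv.coe_addLeft, Prod.ext_iff, Prod.fst_add,
        Prod.snd_add, add_assoc, add_right_inj]
    rw [hc, hu, hu]
  have hD : Δ = klDiv2 lawK u := by
    rw [hΔ]
    simp only [hx]
    rw [← Finset.sum_mul, hp1, one_mul]
  exact ⟨hD.trans hkl, hD⟩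
end
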